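/- For every prime p and integer e ≥ 1, the L-theory SHF-bar_{p,e} has quantifier elimination: for every L-formula φ(x_1,…,x_m) there exists a quantifier-free L-formula ζ(x_1,…,x_m) such that SHF-bar_{p,e} ⊨ ∀x_1…∀x_m (φ(x̄) ↔ ζ(x̄)). -/

import Mathlib

noncomputable section

open FirstOrder FirstOrder.Language

/-- The `m`-th Witt addition polynomial with coefficients reduced mod `p`. -/
def wittHmod (p : ℕ) [Fact p.Prime] (m : ℕ) : MvPolynomial (Fin 2 × ℕ) (ZMod p) :=
  MvPolynomial.map (Int.castRingHom (ZMod p)) (WittVector.wittAdd p m)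

/-- The exponent of the monomial `X̄^i * Ȳ^j`. -/
def xyExp (e : ℕ) (i j : Fin e → ℕ) : (Fin 2 × ℕ) →₀ ℕ :=
  ∑ m : Fin e, (Finsupp.single ((0 : Fin 2), (m : ℕ)) (i m) +
    Finsupp.single ((1 : Fin 2), (m : ℕ)) (j m))

/-- `wittAlpha p e i j l` is the coefficient `α_{i,j}(l) ∈ 𝔽_p` of `X̄^i * Ȳ^j` in
`H_1^{l_1} ⋯ H_e^{l_e}`. -/
def wittAlpha (p : ℕ) [Fact p.Prime] (e : ℕ) (i j l : Fin e → ℕ) : ZMod p :=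
  MvPolynomial.coeff (xyExp e i j) (∏ m : Fin e, (wittHmod p (m : ℕ)) ^ (l m))

/-- `hsComp p e D v = D_{v_1} ∘ (D_{v_2})^(p) ∘ … ∘ (D_{v_e})^(p^{e-1})`. -/
def hsComp {K : Type*} (p e : ℕ) (D : ℕ → K → K) (v : Fin e → ℕ) : K → K :=
  (List.ofFn fun m : Fin e => (D (v m))^[p ^ (m : ℕ)]).foldr (· ∘ ·) id

/-- The language consisting of one unary function symbol `D_n` for each `n ∈ ℕ`. -/
def dLang : FirstOrder.Language :=
  { Functions := fun n => match n with | 1 => ℕ | _ => Empty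
    Relations := fun _ => Empty }

/-- The language `L` of the theory `SHF-bar_{p,e}`: the language of rings `(+, *, -, 0, 1)`
augmented by a unary function symbol `D_n` for each `n ∈ ℕ`. -/
def shfLang : FirstOrder.Language := Language.ring.sum dLang

/-- The unary function symbol `D_n` of `shfLang`. -/
def dSymb (n : ℕ) : shfLang.Functions 1 := Sum.inr n

/-- The interpretation of a function symbol of `shfLang` in a `shfLang`-structure. -/
def shfFun {M : Type*} [shfLang.Structure M] {n : ℕ} (f : shfLang.Functions n)
    (v : Fin n → M) : M :=
  Structure.funMap f v

/-- The interpretation of the symbol `D_n` in a `shfLang`-structure. -/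
def shfD {M : Type*} [shfLang.Structure M] (n : ℕ) (x : M) : M :=
  shfFun (dSymb n) ![x]

/-- A `shfLang`-structure `M` is a model of `SHF-bar_{p,e}` iff:  the ring symbols are
interpreted as the operations of a field structure on `M` of characteristic `p` (H0');
`M` is separably closed (H7', the scheme that every monic polynomial coprime to its formal
derivative has a root); and the operators `D_n := shfD n` satisfy `D_0 = id` and the axiom
schemes H1', H2', H3', H4', H5', H6' and H8'. -/
def IsSHFStructure (p e : ℕ) [Fact p.Prime] (M : Type*) [shfLang.Structure M] : Prop :=
  ∃ (_ : Field M) (_ : CharP M p),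
    (∀ a b : M, shfFun (Sum.inl ringFunc.add) ![a, b] = a + b) ∧
    (∀ a b : M, shfFun (Sum.inl ringFunc.mul) ![a, b] = a * b) ∧
    (∀ a : M, shfFun (Sum.inl ringFunc.neg) ![a] = -a) ∧
    (shfFun (Sum.inl ringFunc.zero) ![] = (0 : M)) ∧
    (shfFun (Sum.inl ringFunc.one) ![] = (1 : M)) ∧
    IsSepClosed M ∧
    (∀ x : M, shfD 0 x = x) ∧
    (∀ n : ℕ, ∀ x y : M, shfD n (x + y) = shfD n x + shfD n y) ∧
    (∀ n : ℕ, ∀ x y : M,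
      shfD n (x * y) = ∑ k ∈ Finset.range (n + 1), shfD k x * shfD (n - k) y) ∧
    (∀ i j : ℕ, ∀ x : M, shfD i (shfD j x) = shfD j (shfD i x)) ∧
    (∀ n : ℕ, 1 ≤ n → ∀ x : M, (shfD n)^[p ^ e] x = 0) ∧
    (∃ x : M, (shfD 1)^[p ^ e - 1] x ≠ 0) ∧
    (∀ x : M, shfD 1 x = 0 → ∃ y : M, x = y ^ p) ∧
    (∀ i j : Fin e → ℕ, ∀ x : M,
      hsComp p e shfD i (hsComp p e shfD j x) =
        ∑ᶠ l : Fin e → ℕ, ZMod.cast (wittAlpha p e i j l) * hsComp p e shfD l x)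

/-- The theory `SHF-bar_{p,e}`, presented as the set of all of its logical consequences:
the set of `shfLang`-sentences true in every structure satisfying the axioms
H0'–H8' (as encoded by `IsSHFStructure`).  A theory presented this way has the same models,
and hence the same satisfiability, completeness and quantifier-elimination properties,
as the axiom system H0'–H8' itself. -/
def shfTheory (p e : ℕ) [Fact p.Prime] : shfLang.Theory :=
  {σ : shfLang.Sentence |
    ∀ (M : Type) (_ : shfLang.Structure M), IsSHFStructure p e M → M ⊨ σ}

/-- Every finite subset of the `κ`-algebra `L` lies in a subalgebra with a `κ`-rational point. -/
def HasRationalPoints (κ L : Type*) [CommRing κ] [CommRing L] [Algebra κ L] : Prop :=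
  ∀ S : Finset L, ∃ O : Subalgebra κ L, (S : Set L) ⊆ O ∧ Nonempty (O →ₐ[κ] κ)

theorem exists_subalgebra_point_of_ker_le {κ R L : Type*} [CommRing κ] [CommRing R] [CommRing L]
    [Algebra κ R] [Algebra κ L] (φ : R →ₐ[κ] L) (ψ : R →ₐ[κ] κ)
    (h : ∀ r, φ r = 0 → ψ r = 0) : Nonempty (φ.range →ₐ[κ] κ) := by
  have hs : Function.Surjective φ.rangeRestrict := φ.rangeRestrict_surjective
  refine ⟨(Ideal.Quotient.liftₐ (RingHom.ker φ.rangeRestrict) ψ ?_).comp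
    (Ideal.quotientKerAlgEquivOfSurjective hs).symm.toAlgHom⟩
  intro a ha
  apply h
  have := congrArg Subtype.val (RingHom.mem_ker.1 ha)
  simpa using this

theorem hasRationalPoints_adjoin_of_algebraicIndependent {κ L : Type*} [Field κ] [Infinite κ]
    [Field L] [Algebra κ L] {s : Set L} (hs : AlgebraicIndependent κ ((↑) : s → L)) :
    HasRationalPoints κ (IntermediateField.adjoin κ s) := by
  classical
  intro S
  have hinj : Function.Injective (MvPolynomial.aeval ((↑) : s → L) : _ →ₐ[κ] L) := hs
  have key : ∀ x : IntermediateField.adjoin κ s, ∃ a b : MvPolynomial s κ,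
      b ≠ 0 ∧ (x : L) * MvPolynomial.aeval ((↑) : s → L) b = MvPolynomial.aeval ((↑) : s → L) a := by
    rintro ⟨x, hx⟩
    have hr : Set.range ((↑) : s → L) = s := Subtype.range_coe
    have hx' : x ∈ IntermediateField.adjoin κ (Set.range ((↑) : s → L)) := by rwa [hr]
    rw [IntermediateField.mem_adjoin_range_iff] at hx'
    obtain ⟨a, b, hab⟩ := hx'
    change ∃ a b : MvPolynomial s κ,
      b ≠ 0 ∧ x * MvPolynomial.aeval ((↑) : s → L) b = MvPolynomial.aeval ((↑) : s → L) a
    by_cases hb : b = 0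
    · refine ⟨0, 1, one_ne_zero, ?_⟩
      rw [hab, hb]; simp
    · refine ⟨a, b, hb, ?_⟩
      have : MvPolynomial.aeval ((↑) : s → L) b ≠ 0 := fun h0 => hb (hinj (by simpa using h0))
      rw [hab]; field_simp
  choose a b hb hab using key
  set h : MvPolynomial s κ := ∏ x ∈ S, b x with hh
  have hh0 : h ≠ 0 := Finset.prod_ne_zero_iff.2 fun x _ => hb x
  obtain ⟨τ, hτ⟩ : ∃ τ : s → κ, MvPolynomial.eval τ h ≠ 0 := by
    by_contra hcon
    push Not at hcon
    exact hh0 (MvPolynomial.funext fun x => by simpa using hcon x)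
  have hmem : ∀ i : s, (i : L) ∈ IntermediateField.adjoin κ s :=
    fun i => IntermediateField.subset_adjoin _ _ i.2
  let g : MvPolynomial s κ →ₐ[κ] IntermediateField.adjoin κ s :=
    MvPolynomial.aeval fun i => ⟨i, hmem i⟩
  have hg : ∀ q, ((g q : IntermediateField.adjoin κ s) : L) =
      MvPolynomial.aeval ((↑) : s → L) q := by
    intro q
    have := MvPolynomial.comp_aeval_apply (R := κ) (fun i : s =>
      (⟨i, hmem i⟩ : IntermediateField.adjoin κ s)) (IntermediateField.adjoin κ s).val q
    simpa using this
  have hginj : Function.Injective g := fun x y hxy => hinj (by rw [← hg, ← hg, hxy])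
  have hgu : ∀ y : Submonoid.powers h, IsUnit (g y) := by
    rintro ⟨_, n, rfl⟩
    simp only [map_pow]
    exact (IsUnit.mk0 _ fun h0 => hh0 (hginj (by simpa using h0))).pow n
  have heu : ∀ y : Submonoid.powers h,
      IsUnit (MvPolynomial.aeval (R := κ) τ (y : MvPolynomial s κ)) := by
    rintro ⟨_, n, rfl⟩
    simp only [map_pow]
    exact (IsUnit.mk0 _ (by simpa [MvPolynomial.aeval_eq_eval] using hτ)).pow n
  let φ : Localization.Away h →ₐ[κ] IntermediateField.adjoin κ s :=
    IsLocalization.liftAlgHom (M := Submonoid.powers h) (f := g) hgu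
  let ψ : Localization.Away h →ₐ[κ] κ :=
    IsLocalization.liftAlgHom (M := Submonoid.powers h) (f := MvPolynomial.aeval (R := κ) τ) heu
  have hφ : ∀ q, φ (algebraMap _ _ q) = g q := fun q => by simp [φ]
  have hφinj : ∀ r, φ r = 0 → r = 0 := by
    intro r hr
    obtain ⟨n, q, hq⟩ := IsLocalization.Away.surj h r
    have := congrArg φ hq
    rw [map_mul, hr, zero_mul, hφ] at this
    have hq0 : q = 0 := hginj (by simpa using this.symm)
    rw [hq0, map_zero] at hq
    have hu : IsUnit (algebraMap (MvPolynomial s κ) (Localization.Away h) h ^ n) :=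
      (IsLocalization.Away.algebraMap_isUnit h).pow n
    exact (hu.mul_left_eq_zero).1 hq
  refine ⟨φ.range, ?_, exists_subalgebra_point_of_ker_le φ ψ fun r hr => by
    rw [hφinj r hr, map_zero]⟩
  intro x hx
  have hx : x ∈ S := hx
  have hdiv : h = b x * ∏ y ∈ S.erase x, b y := (Finset.mul_prod_erase S b hx).symm
  have hu := IsLocalization.Away.algebraMap_isUnit (S := Localization.Away h) h
  refine ⟨algebraMap _ _ (a x * ∏ y ∈ S.erase x, b y) * ↑(hu.unit⁻¹), ?_⟩
  have hgh : g h ≠ 0 := fun h0 => hh0 (hginj (by simpa using h0))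
  apply mul_right_cancel₀ hgh
  change φ _ * g h = x * g h
  rw [map_mul, mul_assoc, ← hφ h, ← map_mul φ (↑hu.unit⁻¹), hu.val_inv_mul, map_one, mul_one, hφ,
    hφ]
  apply Subtype.ext
  rw [IntermediateField.coe_mul, hg, hg, map_mul, ← hab, hdiv, map_mul]
  ring

open Polynomial in
theorem HasRationalPoints.of_isSeparable {κ L : Type*} [Field κ] [IsSepClosed κ]
    [Field L] [Algebra κ L] {L₀ : IntermediateField κ L} (h₀ : HasRationalPoints κ L₀)
    [Algebra.IsSeparable L₀ L] : HasRationalPoints κ L := by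
  classical
  intro S
  have : FiniteDimensional L₀ (IntermediateField.adjoin L₀ (S : Set L)) :=
    IntermediateField.finiteDimensional_adjoin fun x _ => Algebra.IsIntegral.isIntegral x
  obtain ⟨α, hα⟩ := Field.exists_primitive_element L₀ (IntermediateField.adjoin L₀ (S : Set L))
  have hrep : ∀ x : L, ∃ g : L₀[X], x ∈ S → aeval (α : L) g = x := by
    intro x
    by_cases hx : x ∈ S
    · have hx' : (⟨x, IntermediateField.subset_adjoin _ _ hx⟩ :
        IntermediateField.adjoin L₀ (S : Set L)) ∈ IntermediateField.adjoin L₀ {α} := by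
        rw [hα]; trivial
      have hαi : IsAlgebraic L₀ α := (Algebra.IsIntegral.isIntegral α).isAlgebraic
      rw [← IntermediateField.mem_toSubalgebra,
        IntermediateField.adjoin_simple_toSubalgebra_of_isAlgebraic hαi,
        Algebra.adjoin_singleton_eq_range_aeval] at hx'
      obtain ⟨g, hg⟩ := hx'
      refine ⟨g, fun _ => ?_⟩
      have := congrArg (IntermediateField.val _) hg
      change (IntermediateField.val _) (aeval α g) = x at this
      rw [← this, ← aeval_algHom_apply]; rfl
    · exact ⟨0, fun h => (hx h).elim⟩
  choose g hg using hrep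
  set f := minpoly L₀ (α : L) with hf
  have h_int : IsIntegral L₀ (α : L) := Algebra.IsIntegral.isIntegral _
  have hfm : f.Monic := minpoly.monic h_int
  have hfs : f.Separable := Algebra.IsSeparable.isSeparable L₀ (α : L)
  obtain ⟨u, v, huv⟩ := (separable_def' f).1 hfs
  let C : L₀[X] → Finset L₀ := fun q => q.support.image q.coeff
  obtain ⟨O, hO, ⟨χ⟩⟩ := h₀ (C f ∪ C u ∪ C v ∪ S.biUnion fun x => C (g x))
  have hlift : ∀ q : L₀[X], (C q : Set L₀) ⊆ O → ∃ q' : O[X], q'.map (algebraMap O L₀) = q := by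
    intro q hq
    have : q ∈ lifts (algebraMap O L₀) := by
      rw [lifts_iff_coeff_lifts]
      intro n
      by_cases hn : q.coeff n = 0
      · rw [hn]; exact ⟨0, map_zero _⟩
      · refine ⟨⟨q.coeff n, hq ?_⟩, rfl⟩
        simp only [C, Finset.coe_image]
        exact ⟨n, by simpa using hn, rfl⟩
    exact (mem_lifts _).1 this
  have hinj : Function.Injective (algebraMap O L₀) := Subtype.val_injective
  push_cast at hO
  obtain ⟨f', hf'⟩ := hlift f fun x hx => hO (Or.inl (Or.inl (Or.inl hx)))
  obtain ⟨u', hu'⟩ := hlift u fun x hx => hO (Or.inl (Or.inl (Or.inr hx)))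
  obtain ⟨v', hv'⟩ := hlift v fun x hx => hO (Or.inl (Or.inr hx))
  have hgl : ∀ x ∈ S, ∃ q' : O[X], q'.map (algebraMap O L₀) = g x := fun x hx =>
    hlift (g x) fun y hy => hO (Or.inr (Set.mem_biUnion (x := x) hx hy))
  have hfm' : f'.Monic := monic_of_injective hinj (hf' ▸ hfm)
  have hsep' : u' * f' + v' * derivative f' = 1 := by
    apply map_injective _ hinj
    rw [Polynomial.map_add, Polynomial.map_mul, Polynomial.map_mul, ← derivative_map, hf', hu', hv',
      huv, Polynomial.map_one]
  have hsepχ : (f'.map (χ : O →+* κ)).Separable := by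
    rw [separable_def']
    refine ⟨u'.map (χ : O →+* κ), v'.map (χ : O →+* κ), ?_⟩
    rw [derivative_map, ← Polynomial.map_mul, ← Polynomial.map_mul, ← Polynomial.map_add, hsep',
      Polynomial.map_one]
  have hdeg : (f'.map (χ : O →+* κ)).degree ≠ 0 := by
    rw [hfm'.degree_map, ← degree_map_eq_of_injective hinj, hf']
    exact (minpoly.degree_pos h_int).ne'
  obtain ⟨τ, hτ⟩ := IsSepClosed.exists_root _ hdeg hsepχ
  have hτ' : eval₂ (χ : O →+* κ) τ f' = 0 := by rwa [IsRoot, eval_map] at hτ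
  let φ : O[X] →ₐ[κ] L := (aeval (R := O) (α : L)).restrictScalars κ
  let ψ : O[X] →ₐ[κ] κ := eval₂AlgHom χ τ fun _ => Commute.all _ _
  have hφ : ∀ q : O[X], φ q = aeval (α : L) (q.map (algebraMap O L₀)) := by
    intro q
    change aeval (α : L) q = _
    rw [aeval_def, aeval_def, eval₂_map]; rfl
  refine ⟨φ.range, ?_, exists_subalgebra_point_of_ker_le φ ψ ?_⟩
  · intro x hx
    obtain ⟨q, hq⟩ := hgl x hx
    exact ⟨q, by change φ q = x; rw [hφ, hq, hg x hx]⟩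
  · intro r hr
    rw [hφ] at hr
    have hd := minpoly.dvd L₀ (α : L) hr
    rw [← hf, ← hf', map_dvd_map _ hinj hfm'] at hd
    obtain ⟨w, rfl⟩ := hd
    rw [map_mul]
    have hψ : ψ f' = eval₂ (χ : O →+* κ) τ f' := rfl
    rw [hψ, hτ', zero_mul]

theorem IsSepClosed.infinite (κ : Type*) [Field κ] [IsSepClosed κ] : Infinite κ := by
  by_contra h
  have : Finite κ := not_infinite_iff_finite.1 h
  have : IsAlgClosed κ := inferInstance
  exact h IsAlgClosed.instInfinite

/-- A separable extension `L` of a separably closed field `κ` has `κ`-valued specializations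
preserving finitely many polynomial equations and inequations. -/
theorem exists_specialization {κ L ι : Type*} [Field κ] [IsSepClosed κ] [Field L] [Finite ι]
    (p : ℕ) (hp : p.Prime) [CharP κ p] (f : κ →+* L)
    (H : ∀ s : Finset L, (∀ l : L → κ, ∑ x ∈ s, f (l x) * x = 0 → ∀ x ∈ s, l x = 0) →
      ∀ l : L → κ, ∑ x ∈ s, f (l x) * x ^ p = 0 → ∀ x ∈ s, l x = 0)
    (c : ι → L) (T : Finset (MvPolynomial ι κ)) :
    ∃ c' : ι → κ, ∀ q ∈ T, MvPolynomial.eval₂ f c q = 0 ↔ MvPolynomial.eval c' q = 0 := by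
  classical
  let _ := f.toAlgebra
  have := IsSepClosed.infinite κ
  have := ExpChar.prime (R := κ) hp
  let E := IntermediateField.adjoin κ (Set.range c)
  have hE : Algebra.EssFiniteType κ E := 
    IntermediateField.essFiniteType_iff.2 (IntermediateField.fg_adjoin_of_finite (Set.finite_range c))
  have hEs : ∀ s : Finset E, LinearIndepOn κ id (s : Set E) →
      LinearIndepOn κ (fun x : E => x ^ p) (s : Set E) := by
    intro s hs
    rw [linearIndepOn_finset_iff] at hs ⊢
    intro l hl
    let ext : (E → κ) → L → κ := fun l x => if hx : x ∈ E then l ⟨x, hx⟩ else 0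
    have hext : ∀ (l : E → κ) (x : E), ext l x = l x := fun l x => by simp [ext]
    let emb : E ↪ L := ⟨Subtype.val, Subtype.val_injective⟩
    have := H (s.map emb) ?_ (ext l) ?_
    · intro i hi
      have h1 := this i (Finset.mem_map_of_mem emb hi)
      rwa [hext] at h1
    · intro l' hl' x hx
      obtain ⟨y, hy, rfl⟩ := Finset.mem_map.1 hx
      refine hs (fun i => l' i) ?_ y hy
      rw [Finset.sum_map] at hl'
      apply Subtype.ext
      rw [← IntermediateField.coe_val, map_sum, map_zero, ← hl']
      rfl
    · rw [Finset.sum_map]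
      have := congrArg (IntermediateField.val E) hl
      rw [map_sum, map_zero] at this
      rw [← this]
      refine Finset.sum_congr rfl fun x _ => ?_
      change f (ext l x) * _ = _
      rw [hext]; rfl
  obtain ⟨s, hs, hsep⟩ :=
    exists_isTranscendenceBasis_and_isSeparable_of_linearIndepOn_pow_of_essFiniteType p hp hEs
  have hpts : HasRationalPoints κ E :=
    (hasRationalPoints_adjoin_of_algebraicIndependent hs.1).of_isSeparable
  let cE : ι → E := fun i => ⟨c i, IntermediateField.subset_adjoin _ _ ⟨i, rfl⟩⟩
  have hc : ∀ q : MvPolynomial ι κ, (MvPolynomial.aeval cE q : E) = MvPolynomial.eval₂ f c q := by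
    intro q
    exact (MvPolynomial.comp_aeval_apply cE E.val q)
  have := Fintype.ofFinite ι
  obtain ⟨O, hO, ⟨χ⟩⟩ := hpts (Finset.univ.image cE ∪ T.image fun q => (MvPolynomial.aeval cE q)⁻¹)
  push_cast at hO
  let cO : ι → O := fun i => ⟨cE i, hO (Or.inl ⟨i, by simp, rfl⟩)⟩
  have hcO : ∀ q : MvPolynomial ι κ, (MvPolynomial.aeval cO q : E) = MvPolynomial.aeval cE q :=
    fun q => MvPolynomial.comp_aeval_apply cO O.val q
  have hχ : ∀ q : MvPolynomial ι κ, MvPolynomial.eval (fun i => χ (cO i)) q =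
      χ (MvPolynomial.aeval cO q) := by
    intro q
    rw [MvPolynomial.comp_aeval_apply, MvPolynomial.aeval_eq_eval]
  refine ⟨fun i => χ (cO i), fun q hq => ?_⟩
  rw [hχ, ← hc, ← hcO]
  constructor
  · intro h
    have : MvPolynomial.aeval cO q = 0 := Subtype.ext (Subtype.ext h)
    rw [this, map_zero]
  · intro h
    by_contra hne
    have hne' : MvPolynomial.aeval cE q ≠ 0 := fun h0 => hne (by rw [hcO, h0]; rfl)
    let d : O := ⟨(MvPolynomial.aeval cE q)⁻¹, hO (Or.inr ⟨q, hq, rfl⟩)⟩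
    have hd : MvPolynomial.aeval cO q * d = 1 := by
      apply Subtype.ext
      change (MvPolynomial.aeval cO q : E) * (MvPolynomial.aeval cE q)⁻¹ = 1
      rw [hcO, mul_inv_cancel₀ hne']
    have := congrArg χ hd
    rw [map_mul, h, zero_mul, map_one] at this
    exact zero_ne_one this

/-- A higher derivation (Hasse–Schmidt derivation) on a commutative ring. -/
structure IsHasse {R : Type*} [CommRing R] (D : ℕ → R → R) : Prop where
  zero_apply : ∀ x, D 0 x = x
  map_add : ∀ n x y, D n (x + y) = D n x + D n y
  map_mul : ∀ n x y, D n (x * y) = ∑ k ∈ Finset.range (n + 1), D k x * D (n - k) y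

namespace IsHasse

variable {F : Type*} [Field F] {D : ℕ → F → F}

theorem map_zero (h : IsHasse D) (n : ℕ) : D n 0 = 0 := by simpa using h.map_add n 0 0

theorem map_neg (h : IsHasse D) (n : ℕ) (x : F) : D n (-x) = -D n x := by
  have := h.map_add n x (-x)
  rw [add_neg_cancel, h.map_zero] at this
  exact eq_neg_of_add_eq_zero_right this.symm

theorem map_sum (h : IsHasse D) {ι : Type*} (n : ℕ) (s : Finset ι) (f : ι → F) :
    D n (∑ i ∈ s, f i) = ∑ i ∈ s, D n (f i) :=
  _root_.map_sum (⟨⟨D n, h.map_zero n⟩, h.map_add n⟩ : F →+ F) f s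

/-- If the derivatives of `c` of orders `0 < k < n` vanish, then only the extreme terms of the
Leibniz rule survive. -/
theorem map_mul_of_lt (h : IsHasse D) {n : ℕ} (hn : 0 < n) {c : F}
    (hc : ∀ k, 0 < k → k < n → D k c = 0) (x : F) :
    D n (c * x) = c * D n x + D n c * x := by
  rw [h.map_mul, Finset.sum_range_succ, Nat.sub_self, h.zero_apply]
  congr 1
  rw [Finset.sum_eq_single_of_mem 0 (by simpa using hn), Nat.sub_zero, h.zero_apply]
  intro k hk hk0
  rw [hc k (Nat.pos_of_ne_zero hk0) (by simpa using hk), zero_mul]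

theorem map_one (h : IsHasse D) {n : ℕ} (hn : 0 < n) : D n 1 = 0 := by
  induction n using Nat.strong_induction_on with
  | _ n ih =>
    have := h.map_mul_of_lt hn (c := 1) (fun k hk hkn => ih k hkn hk) 1
    simpa using this

/-- The field of elements killed by `D 1, …, D (N - 1)`. -/
def constants (h : IsHasse D) (N : ℕ) : Subfield F where
  carrier := {x | ∀ j, 0 < j → j < N → D j x = 0}
  zero_mem' := fun j _ _ => h.map_zero j
  one_mem' := fun _ hj _ => h.map_one hj
  add_mem' := fun hx hy j hj hjN => by rw [h.map_add, hx j hj hjN, hy j hj hjN, add_zero]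
  neg_mem' := fun hx j hj hjN => by rw [h.map_neg, hx j hj hjN, neg_zero]
  mul_mem' := fun {x y} hx hy j hj hjN => by
    rw [h.map_mul_of_lt hj (fun k hk hkj => hx k hk (hkj.trans hjN)), hx j hj hjN, hy j hj hjN]
    simp
  inv_mem' := fun x hx j hj hjN => by
    by_cases hx0 : x = 0
    · rw [hx0, inv_zero, h.map_zero]
    have := h.map_mul_of_lt hj (fun k hk hkj => hx k hk (hkj.trans hjN)) x⁻¹
    rw [mul_inv_cancel₀ hx0, h.map_one hj, hx j hj hjN, zero_mul, add_zero] at this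
    exact (mul_eq_zero.1 this.symm).resolve_left hx0

theorem map_constants_mul (h : IsHasse D) {N n : ℕ} (hn : n < N) {c : F}
    (hc : c ∈ h.constants N) (x : F) :
    D n (c * x) = c * D n x := by
  rcases Nat.eq_zero_or_pos n with rfl | hn0
  · rw [h.zero_apply, h.zero_apply]
  · rw [h.map_mul_of_lt hn0 (fun k hk hkn => hc k hk (hkn.trans hn)), hc n hn0 hn]
    simp

theorem exists_constants_mem_of_stable (h : IsHasse D) {ι : Type*} [Fintype ι] (N : ℕ)
    (V : Submodule F (ι → F))
    (hV : ∀ v ∈ V, ∀ j, 0 < j → j < N → (fun i => D j (v i)) ∈ V) (hne : V ≠ ⊥) :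
    ∃ v ∈ V, v ≠ 0 ∧ ∀ i, v i ∈ h.constants N := by
  classical
  let supp : (ι → F) → Finset ι := fun v => Finset.univ.filter fun i => v i ≠ 0
  obtain ⟨w, hwV, hw0⟩ := Submodule.exists_mem_ne_zero_of_ne_bot hne
  have hex : ∃ m, ∃ v ∈ V, v ≠ 0 ∧ (supp v).card = m := ⟨_, w, hwV, hw0, rfl⟩
  obtain ⟨v, hvV, hv0, hvm⟩ := Nat.find_spec hex
  have hmin : ∀ u ∈ V, (supp u).card < (supp v).card → u = 0 := by
    intro u hu hlt
    by_contra hu0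
    exact Nat.find_min hex (hvm ▸ hlt) ⟨u, hu, hu0, rfl⟩
  obtain ⟨i₀, hi₀⟩ := Function.ne_iff.1 hv0
  have hi₀ : v i₀ ≠ 0 := hi₀
  have hsupp : ∀ i, ((v i₀)⁻¹ • v) i ≠ 0 → v i ≠ 0 := fun i hi hvi => hi (by simp [hvi])
  refine ⟨(v i₀)⁻¹ • v, V.smul_mem _ hvV, smul_ne_zero (inv_ne_zero hi₀) hv0, fun i j hj hjN => ?_⟩
  have hz : (fun i => D j (((v i₀)⁻¹ • v) i)) = 0 := by
    refine hmin _ (hV _ (V.smul_mem _ hvV) j hj hjN) (Finset.card_lt_card ?_)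
    refine Finset.ssubset_iff_subset_ne.2 ⟨fun i hi => ?_, fun heq => ?_⟩
    · simp only [supp, Finset.mem_filter, Finset.mem_univ, true_and] at hi ⊢
      intro hvi
      exact hi (by simp [hvi, h.map_zero])
    · have : i₀ ∈ supp v := by simpa [supp] using hi₀
      rw [← heq] at this
      simp [supp, hi₀, h.map_one hj] at this
  exact congrFun hz i

/-- A field on which finitely many operators span a space stable under `D 1, …, D (N - 1)` has
degree at most the number of these operators over the constants. -/
theorem card_le_of_constants_independent (h : IsHasse D) {ι Ω : Type*} [Fintype ι]
    [Fintype Ω] (N : ℕ)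
    (E : Ω → F → F) (ω₀ : Ω) (h₀ : ∀ x, E ω₀ x = x)
    (hE : ∀ j < N, ∀ ω, ∃ a : Ω → F, ∀ x, D j (E ω x) = ∑ ω', a ω' * E ω' x)
    (x : ι → F) (hx : ∀ c : ι → F, (∀ i, c i ∈ h.constants N) → ∑ i, c i * x i = 0 → c = 0) :
    Fintype.card ι ≤ Fintype.card Ω := by
  by_contra hlt
  push Not at hlt
  let T : (ι → F) →ₗ[F] (Ω → F) :=
    { toFun := fun v ω => ∑ i, v i * E ω (x i)
      map_add' := fun v w => by ext ω; simp [add_mul, Finset.sum_add_distrib]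
      map_smul' := fun a v => by ext ω; simp [mul_assoc, Finset.mul_sum] }
  have hker : LinearMap.ker T ≠ ⊥ := LinearMap.ker_ne_bot_of_finrank_lt (by simpa using hlt)
  have hstab : ∀ v ∈ LinearMap.ker T, ∀ j, 0 < j → j < N → (fun i => D j (v i)) ∈ LinearMap.ker T := by
    intro v hv j
    induction j using Nat.strong_induction_on with
    | _ j ih =>
      intro hj hjN
      have hTv : ∀ k < j, 0 < k → ∀ ω, ∑ i, D k (v i) * E ω (x i) = 0 := fun k hk hk0 ω =>
        congrFun (LinearMap.mem_ker.1 (ih k hk hk0 (hk.trans hjN))) ω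
      have hv0 : ∀ ω, ∑ i, v i * E ω (x i) = 0 := fun ω => congrFun (LinearMap.mem_ker.1 hv) ω
      rw [LinearMap.mem_ker]
      ext ω
      change ∑ i, D j (v i) * E ω (x i) = 0
      have hcomb : ∀ (w : ι → F), (∀ ω, ∑ i, w i * E ω (x i) = 0) → ∀ m < N,
          ∑ i, w i * D m (E ω (x i)) = 0 := by
        intro w hw m hm
        obtain ⟨a, ha⟩ := hE m hm ω
        simp only [ha, Finset.mul_sum]
        rw [Finset.sum_comm]
        refine Finset.sum_eq_zero fun ω' _ => ?_
        rw [← mul_zero (a ω'), ← hw ω', Finset.mul_sum]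
        exact Finset.sum_congr rfl fun i _ => by ring
      have h1 := congrArg (D j) (hv0 ω)
      rw [h.map_sum, h.map_zero] at h1
      simp only [h.map_mul] at h1
      rw [Finset.sum_comm, Finset.sum_range_succ, Nat.sub_self, Finset.sum_eq_zero, zero_add] at h1
      · simpa only [h.zero_apply] using h1
      · intro k hk
        have hkj : k < j := by simpa using hk
        refine hcomb (fun i => D k (v i)) (fun ω => ?_) (j - k) (by omega)
        rcases Nat.eq_zero_or_pos k with rfl | hk0
        · simpa only [h.zero_apply] using hv0 ω
        · exact hTv k hkj hk0 ω
  obtain ⟨v, hv, hv0, hvC⟩ := h.exists_constants_mem_of_stable N _ hstab hker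
  refine hv0 (hx v hvC ?_)
  have : ∑ i, v i * E ω₀ (x i) = 0 := congrFun (LinearMap.mem_ker.1 hv) ω₀
  simpa only [h₀] using this

theorem exists_constants_combination (h : IsHasse D) {ι : Type*} [Fintype ι] (N : ℕ)
    (hbound : ∀ x : Option ι → F,
      ∃ c : Option ι → F, (∀ i, c i ∈ h.constants N) ∧ ∑ i, c i * x i = 0 ∧ c ≠ 0)
    (b : ι → F) (hb : ∀ c : ι → F, (∀ i, c i ∈ h.constants N) → ∑ i, c i * b i = 0 → c = 0)
    (z : F) : ∃ c : ι → F, (∀ i, c i ∈ h.constants N) ∧ z = ∑ i, c i * b i := by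
  obtain ⟨c, hc, hs, hne⟩ := hbound (fun o => o.elim z b)
  rw [Fintype.sum_option] at hs
  simp only [Option.elim_none, Option.elim_some] at hs
  by_cases hn : c none = 0
  · rw [hn, zero_mul, zero_add] at hs
    have := hb (fun i => c (some i)) (fun i => hc _) hs
    refine (hne ?_).elim
    funext o
    cases o with
    | none => exact hn
    | some i => exact congrFun this i
  · refine ⟨fun i => -(c none)⁻¹ * c (some i),
      fun i => mul_mem (neg_mem (inv_mem (hc _))) (hc _), ?_⟩
    simp only [mul_assoc, ← Finset.mul_sum]
    field_simp
    linear_combination hs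

end IsHasse

section Extension

variable {K F : Type*} [Field K] [Field F] {D : ℕ → K → K} {D' : ℕ → F → F}
  (h : IsHasse D) (h' : IsHasse D')
  {N : ℕ} (f : K →+* F)

theorem IsHasse.independent_of_constants
    (hf : ∀ j < N, ∀ x, f (D j x) = D' j (f x)) {ι : Type*} [Fintype ι] (u : ι → F)
    (hu : ∀ i, u i ∈ h'.constants N)
    (hind : ∀ c : ι → K, (∀ i, c i ∈ h.constants N) → ∑ i, f (c i) * u i = 0 → c = 0)
    (c : ι → K) (hc : ∑ i, f (c i) * u i = 0) : c = 0 := by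
  let V : Submodule K (ι → K) :=
    { carrier := {v | ∑ i, f (v i) * u i = 0}
      zero_mem' := by simp
      add_mem' := fun {v w} hv hw => by
        change ∑ i, f (v i) * u i = 0 at hv
        change ∑ i, f (w i) * u i = 0 at hw
        simp [add_mul, Finset.sum_add_distrib, hv, hw]
      smul_mem' := fun a v hv => by
        change ∑ i, f (v i) * u i = 0 at hv
        simp [mul_assoc, ← Finset.mul_sum, hv] }
  by_contra hne
  have hV : V ≠ ⊥ := fun hb => hne (by
    have : c ∈ V := hc
    rwa [hb, Submodule.mem_bot] at this)
  obtain ⟨v, hv, hv0, hvC⟩ := h.exists_constants_mem_of_stable N V (fun v hv j hj hjN => by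
    change ∑ i, f (D j (v i)) * u i = 0
    have := congrArg (D' j) (show ∑ i, f (v i) * u i = 0 from hv)
    rw [h'.map_sum, h'.map_zero] at this
    rw [← this]
    refine Finset.sum_congr rfl fun i _ => ?_
    rw [mul_comm (f (v i)), h'.map_constants_mul hjN (hu i), hf j hjN, mul_comm]) hV
  exact hv0 (hind v hvC hv)

theorem IsHasse.independent_over_constants
    (hf : ∀ j < N, ∀ x, f (D j x) = D' j (f x)) {ι : Type*} [Fintype ι] (b : ι → K)
    (hb : ∀ c : ι → K, (∀ i, c i ∈ h.constants N) → ∑ i, c i * b i = 0 → c = 0)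
    (c : ι → F) (hc : ∀ i, c i ∈ h'.constants N) (hs : ∑ i, c i * f (b i) = 0) : c = 0 := by
  classical
  let g : h.constants N →+* F := f.comp (h.constants N).subtype
  let _ : Module (h.constants N) F := Module.compHom F g
  have hsmul : ∀ (a : h.constants N) (x : F), a • x = f a * x := fun _ _ => rfl
  let W := Submodule.span (h.constants N) (Set.range c)
  have : Module.Finite (h.constants N) W :=
    Module.Finite.span_of_finite _ (Set.finite_range c)
  let B := Module.finBasis (h.constants N) W
  have hWC : ∀ w ∈ W, w ∈ h'.constants N := by
    intro w hw
    induction hw using Submodule.span_induction with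
    | mem x hx => obtain ⟨i, rfl⟩ := hx; exact hc i
    | zero => exact zero_mem _
    | add x y _ _ hx hy => exact add_mem hx hy
    | smul a x _ hx =>
      rw [hsmul]
      refine mul_mem (fun j hj hjN => ?_) hx
      rw [← hf j hjN, a.2 j hj hjN, _root_.map_zero]
  let cW : ι → W := fun i => ⟨c i, Submodule.subset_span ⟨i, rfl⟩⟩
  have hrepr : ∀ i, c i = ∑ l, f (B.repr (cW i) l) * (B l : F) := by
    intro i
    have := congrArg (Subtype.val) (B.sum_repr (cW i))
    rw [← show ((cW i : W) : F) = c i from rfl, ← this, AddSubmonoidClass.coe_finsetSum]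
    rfl
  have hBl := h.independent_of_constants h' f hf (fun l => (B l : F)) (fun l => hWC _ (B l).2)
    (fun a ha hsum => by
      have hli := Fintype.linearIndependent_iff.1 B.linearIndependent (fun l => ⟨a l, ha l⟩) (by
        apply Subtype.ext
        rw [AddSubmonoidClass.coe_finsetSum]
        exact hsum)
      funext l
      exact congrArg Subtype.val (hli l))
    (fun l => ∑ i, (B.repr (cW i) l : K) * b i) (by
      rw [← hs]
      simp only [_root_.map_sum, _root_.map_mul, Finset.sum_mul]
      rw [Finset.sum_comm]
      refine Finset.sum_congr rfl fun i _ => ?_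
      rw [hrepr i, Finset.sum_mul]
      exact Finset.sum_congr rfl fun l _ => by ring)
  funext i
  have hz : ∀ l, (B.repr (cW i) l : K) = 0 := fun l =>
    congrFun (hb (fun i => (B.repr (cW i) l : K)) (fun i => (B.repr (cW i) l).2)
      (congrFun hBl l)) i
  rw [hrepr i]
  simp [hz]

end Extension

section Amalgam

open MvPowerSeries TensorProduct

variable {τ : Type}

/-- A series expansion on a nontrivial ring `R` induces one on the fraction field of the quotient
of `R` by a minimal prime ideal. -/
theorem exists_expansion_of_nontrivial {R : Type} [CommRing R] [Nontrivial R]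
    (φ : R →+* MvPowerSeries τ R) (hφ : ∀ x, constantCoeff (φ x) = x) :
    ∃ (F : Type) (_ : Field F) (π : R →+* F) (Φ : F →+* MvPowerSeries τ F),
      (∀ x, Φ (π x) = map π (φ x)) ∧ (∀ x, constantCoeff (Φ x) = x) ∧
      ∀ (C : Type) [CommRing C] (a b : F →+* C), a.comp π = b.comp π → a = b := by
  obtain ⟨P, hP⟩ := Ideal.nonempty_minimalPrimes (R := R) (I := ⊥) top_ne_bot.symm
  have hprime : P.IsPrime := hP.1.1
  let F := FractionRing (R ⧸ P)
  let π : R →+* F := (algebraMap (R ⧸ P) F).comp (Ideal.Quotient.mk P)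
  have hπ : ∀ x, π x = 0 ↔ x ∈ P := fun x => by
    rw [RingHom.comp_apply, map_eq_zero_iff _ (IsFractionRing.injective (R ⧸ P) F),
      Ideal.Quotient.eq_zero_iff_mem]
  let ψ : R →+* MvPowerSeries τ F := (map π).comp φ
  have hψ0 : ∀ x, constantCoeff (ψ x) = π x := fun x => by
    simp [ψ, hφ]
  have hψ : ∀ x ∈ P, ψ x = 0 := by
    intro x hx
    have h0 : (0 : R) ∈ P.primeCompl ⊔ Submonoid.powers x := by
      by_contra h0
      obtain ⟨Q, hQ, -, hQS⟩ := Ideal.exists_le_prime_disjoint ⊥ (P.primeCompl ⊔ Submonoid.powers x)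
        (Set.disjoint_left.2 fun y hy hyS => h0 (by rwa [← Ideal.mem_bot.1 hy]))
      rw [Set.disjoint_left] at hQS
      have hQP : Q ≤ P := fun y hy => by
        by_contra hyP
        exact hQS hy (Submonoid.mem_sup_left hyP)
      exact hQS (hP.2 ⟨hQ, bot_le⟩ hQP hx) (Submonoid.mem_sup_right (Submonoid.mem_powers x))
    obtain ⟨y, hy, z, ⟨n, rfl⟩, hyz⟩ := Submonoid.mem_sup.1 h0
    have h1 : ψ y * ψ x ^ n = 0 := by rw [← map_pow, ← map_mul, hyz, map_zero]
    refine eq_zero_of_pow_eq_zero ((mul_eq_zero.1 h1).resolve_left fun h => hy ?_)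
    exact (hπ y).1 (by rw [← hψ0, h, _root_.map_zero])
  let χ : R ⧸ P →+* MvPowerSeries τ F := Ideal.Quotient.lift P ψ hψ
  have hχ : ∀ x, χ (Ideal.Quotient.mk P x) = ψ x := fun x => rfl
  have hunit : ∀ y : nonZeroDivisors (R ⧸ P), IsUnit (χ y) := by
    rintro ⟨y, hy⟩
    obtain ⟨x, rfl⟩ := Ideal.Quotient.mk_surjective y
    rw [MvPowerSeries.isUnit_iff_constantCoeff, hχ, hψ0, isUnit_iff_ne_zero, Ne, hπ,
      ← Ideal.Quotient.eq_zero_iff_mem]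
    exact nonZeroDivisors.ne_zero hy
  have hext : ∀ (C : Type) [CommRing C] (a b : F →+* C), a.comp π = b.comp π → a = b := by
    intro C _ a b hab
    refine IsLocalization.ringHom_ext (nonZeroDivisors (R ⧸ P)) ?_
    refine Ideal.Quotient.ringHom_ext ?_
    exact hab
  let Φ : F →+* MvPowerSeries τ F := IsLocalization.lift hunit
  have hΦ : ∀ x, Φ (π x) = ψ x := fun x => IsLocalization.lift_eq hunit _
  refine ⟨F, inferInstance, π, Φ, hΦ, ?_, hext⟩
  refine RingHom.congr_fun (hext F (constantCoeff.comp Φ) (RingHom.id F) ?_)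
  ext x
  simp [hΦ, hψ0]

/-- Two fields with series expansions which agree on a common subring can be amalgamated. -/
theorem exists_amalgam {S K K' : Type} [CommRing S] [IsDomain S] [Field K] [Field K']
    (g : S →+* K) (g' : S →+* K') (hg : Function.Injective g) (hg' : Function.Injective g')
    (φ : K →+* MvPowerSeries τ K) (hφ : ∀ x, constantCoeff (φ x) = x)
    (φ' : K' →+* MvPowerSeries τ K') (hφ' : ∀ x, constantCoeff (φ' x) = x)
    (hS : ∀ s n, ∃ t, coeff n (φ (g s)) = g t ∧ coeff n (φ' (g' s)) = g' t) :
    ∃ (F : Type) (_ : Field F) (ι : K →+* F) (ι' : K' →+* F) (Φ : F →+* MvPowerSeries τ F),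
      (∀ s, ι (g s) = ι' (g' s)) ∧ (∀ x, Φ (ι x) = map ι (φ x)) ∧
      (∀ x, Φ (ι' x) = map ι' (φ' x)) ∧ (∀ x, constantCoeff (Φ x) = x) ∧
      ∀ (C : Type) [CommRing C] (a b : F →+* C),
        a.comp ι = b.comp ι → a.comp ι' = b.comp ι' → a = b := by
  let k := FractionRing S
  let i : k →+* K := IsFractionRing.lift hg
  let i' : k →+* K' := IsFractionRing.lift hg'
  have hi : ∀ s, i (algebraMap S k s) = g s := fun s => IsFractionRing.lift_algebraMap hg s
  have hi' : ∀ s, i' (algebraMap S k s) = g' s := fun s => IsFractionRing.lift_algebraMap hg' s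
  let _ : Algebra k K := i.toAlgebra
  let _ : Algebra k K' := i'.toAlgebra
  let R := K ⊗[k] K'
  let l : K →+* R := (Algebra.TensorProduct.includeLeft : K →ₐ[k] R).toRingHom
  let r : K' →+* R := (Algebra.TensorProduct.includeRight : K' →ₐ[k] R).toRingHom
  have hlr : ∀ c, l (i c) = r (i' c) := fun c =>
    ((Algebra.TensorProduct.includeLeft : K →ₐ[k] R).commutes c).trans
      ((Algebra.TensorProduct.includeRight : K' →ₐ[k] R).commutes c).symm
  have hagree : (map l).comp (φ.comp i) = (map r).comp (φ'.comp i') := by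
    refine IsLocalization.ringHom_ext (nonZeroDivisors S) ?_
    ext s n
    simp only [RingHom.comp_apply, hi, hi', coeff_map]
    obtain ⟨t, ht, ht'⟩ := hS s n
    rw [ht, ht', ← hi, ← hi', hlr]
  let _ : Algebra k (MvPowerSeries τ R) := ((map l).comp (φ.comp i)).toAlgebra
  let a : K →ₐ[k] MvPowerSeries τ R := { (map l).comp φ with commutes' := fun _ => rfl }
  let b : K' →ₐ[k] MvPowerSeries τ R :=
    { (map r).comp φ' with commutes' := fun c => (RingHom.congr_fun hagree c).symm }
  let φR : R →+* MvPowerSeries τ R := (Algebra.TensorProduct.productMap a b).toRingHom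
  have hl : ∀ x, φR (l x) = map l (φ x) := fun x => Algebra.TensorProduct.productMap_left_apply a b x
  have hr : ∀ x, φR (r x) = map r (φ' x) := fun x =>
    Algebra.TensorProduct.productMap_right_apply a b x
  have hext : ∀ (C : Type) [CommRing C] (u v : R →+* C),
      u.comp l = v.comp l → u.comp r = v.comp r → u = v := by
    intro C _ u v h1 h2
    refine RingHom.ext fun x => ?_
    induction x using TensorProduct.induction_on with
    | zero => simp
    | add x y hx hy => rw [map_add, map_add, hx, hy]
    | tmul x y =>
      have : x ⊗ₜ[k] y = l x * r y :=
        (congrArg₂ _ (mul_one x).symm (one_mul y).symm).trans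
          (Algebra.TensorProduct.tmul_mul_tmul x 1 1 y).symm
      rw [this, map_mul, map_mul]
      exact congrArg₂ _ (RingHom.congr_fun h1 x) (RingHom.congr_fun h2 y)
  have hφR : ∀ x, constantCoeff (φR x) = x := by
    refine RingHom.congr_fun (hext R (constantCoeff.comp φR) (RingHom.id R) ?_ ?_)
    · ext x
      simp [hl, hφ]
    · ext x
      simp [hr, hφ']
  obtain ⟨F, _, π, Φ, hΦ, hΦ0, hπ⟩ := exists_expansion_of_nontrivial φR hφR
  refine ⟨F, inferInstance, π.comp l, π.comp r, Φ, ?_, ?_, ?_, hΦ0, ?_⟩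
  · intro s
    rw [RingHom.comp_apply, RingHom.comp_apply, ← hi, ← hi', hlr]
  · intro x
    rw [RingHom.comp_apply, hΦ, hl]
    ext n
    simp
  · intro x
    rw [RingHom.comp_apply, hΦ, hr]
    ext n
    simp
  · intro C _ u v h1 h2
    exact hπ C u v (hext C _ _ h1 h2)

end Amalgam

section Iterativity

open MvPowerSeries

variable {e : ℕ}

theorem xyExp_apply (i j : Fin e → ℕ) (a : Fin 2) (n : ℕ) :
    xyExp e i j (a, n) = if h : n < e then (if a = 0 then i ⟨n, h⟩ else j ⟨n, h⟩) else 0 := by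
  have key : ∀ m : Fin e, (Finsupp.single ((0 : Fin 2), (m : ℕ)) (i m) +
      Finsupp.single ((1 : Fin 2), (m : ℕ)) (j m)) (a, n) =
      if (m : ℕ) = n then (if a = 0 then i m else j m) else 0 := by
    intro m
    fin_cases a <;> simp [Finsupp.single_apply]
  rw [xyExp, Finsupp.finsetSum_apply]
  refine (Finset.sum_congr rfl fun m _ => key m).trans ?_
  by_cases h : n < e
  · rw [dif_pos h, Finset.sum_eq_single (⟨n, h⟩ : Fin e)]
    · simp
    · intro m _ hm
      rw [if_neg fun hmn => hm (Fin.ext hmn)]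
    · simp
  · rw [dif_neg h]
    refine Finset.sum_eq_zero fun m _ => if_neg ?_
    rintro rfl
    exact h m.2

theorem xyExp_add (i j i' j' : Fin e → ℕ) :
    xyExp e (i + i') (j + j') = xyExp e i j + xyExp e i' j' := by
  ext ⟨a, n⟩
  simp only [Finsupp.add_apply, xyExp_apply]
  split_ifs <;> simp

theorem xyExp_injective {i j i' j' : Fin e → ℕ} (h : xyExp e i j = xyExp e i' j') :
    i = i' ∧ j = j' := by
  constructor
  · funext m
    simpa [xyExp_apply] using DFunLike.congr_fun h (0, (m : ℕ))
  · funext m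
    simpa [xyExp_apply] using DFunLike.congr_fun h (1, (m : ℕ))

/-- The exponents bounded by some `xyExp e i j` are themselves of this form. -/
theorem eq_xyExp_of_add_eq {i j : Fin e → ℕ} {u v : Fin 2 × ℕ →₀ ℕ} (h : u + v = xyExp e i j) :
    u = xyExp e (fun m => u (0, m)) (fun m => u (1, m)) := by
  ext ⟨a, n⟩
  have := DFunLike.congr_fun h (a, n)
  rw [Finsupp.add_apply, xyExp_apply] at this
  rw [xyExp_apply]
  split_ifs at this ⊢ with hn ha
  · rw [ha]
  · rw [show a = 1 by omega]
  · omega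

/-- The part of a power series in the variables `X̄`, `Ȳ`, as an iterated power series. -/
def xyPart (e : ℕ) {R : Type*} [CommRing R] (f : MvPowerSeries (Fin 2 × ℕ) R) :
    MvPowerSeries (Fin e) (MvPowerSeries (Fin e) R) :=
  fun j i => coeff (xyExp e i j) f

theorem coeff_coeff_xyPart {R : Type*} [CommRing R] (f : MvPowerSeries (Fin 2 × ℕ) R)
    (i j : Fin e →₀ ℕ) : coeff i (coeff j (xyPart e f)) = coeff (xyExp e i j) f := rfl

/-- The ring homomorphism extracting the part of a power series in the variables `X̄`, `Ȳ`. -/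
def xySeries (e : ℕ) (R : Type*) [CommRing R] :
    MvPowerSeries (Fin 2 × ℕ) R →+* MvPowerSeries (Fin e) (MvPowerSeries (Fin e) R) where
  toFun := xyPart e
  map_zero' := by
    refine MvPowerSeries.ext fun j => MvPowerSeries.ext fun i => ?_
    exact MvPowerSeries.coeff_zero _
  map_add' f g := by
    refine MvPowerSeries.ext fun j => MvPowerSeries.ext fun i => ?_
    exact map_add (coeff (xyExp e i j)) f g
  map_one' := by
    classical
    refine MvPowerSeries.ext fun j => MvPowerSeries.ext fun i => ?_
    rw [coeff_coeff_xyPart]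
    have h0 : xyExp e 0 0 = 0 := by
      ext ⟨a, n⟩
      simp [xyExp_apply]
    rw [MvPowerSeries.coeff_one, MvPowerSeries.coeff_one]
    by_cases hj : j = 0
    · subst hj
      rw [if_pos rfl, MvPowerSeries.coeff_one]
      refine if_congr ⟨fun h => ?_, fun h => ?_⟩ rfl rfl
      · exact DFunLike.coe_injective (xyExp_injective (h.trans h0.symm)).1
      · rw [h]
        exact h0
    · rw [if_neg hj, map_zero, if_neg]
      exact fun h => hj (DFunLike.coe_injective (xyExp_injective (h.trans h0.symm)).2)
  map_mul' f g := by
    classical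
    refine MvPowerSeries.ext fun j => MvPowerSeries.ext fun i => ?_
    rw [coeff_coeff_xyPart, MvPowerSeries.coeff_mul, MvPowerSeries.coeff_mul, map_sum]
    simp only [MvPowerSeries.coeff_mul]
    rw [← Finset.sum_product']
    symm
    refine Finset.sum_bij
      (fun q _ => (xyExp e q.2.1 q.1.1, xyExp e q.2.2 q.1.2)) ?_ ?_ ?_ ?_
    · rintro ⟨⟨j1, j2⟩, ⟨i1, i2⟩⟩ hq
      simp only [Finset.mem_product, Finset.HasAntidiagonal.mem_antidiagonal] at hq ⊢
      rw [← xyExp_add, ← hq.1, ← hq.2]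
      rfl
    · rintro ⟨⟨j1, j2⟩, ⟨i1, i2⟩⟩ _ ⟨⟨j1', j2'⟩, ⟨i1', i2'⟩⟩ _ heq
      simp only [Prod.mk.injEq] at heq ⊢
      have h1 := xyExp_injective heq.1
      have h2 := xyExp_injective heq.2
      exact ⟨⟨DFunLike.coe_injective h1.2, DFunLike.coe_injective h2.2⟩,
        DFunLike.coe_injective h1.1, DFunLike.coe_injective h2.1⟩
    · rintro ⟨u, v⟩ huv
      rw [Finset.HasAntidiagonal.mem_antidiagonal] at huv
      have hu := eq_xyExp_of_add_eq huv
      have hv := eq_xyExp_of_add_eq ((add_comm v u).trans huv)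
      have hsum : xyExp e i j = xyExp e (fun m => u (0, m) + v (0, m))
          (fun m => u (1, m) + v (1, m)) := by
        rw [← huv]
        conv_lhs => rw [hu, hv]
        exact (xyExp_add _ _ _ _).symm
      obtain ⟨hi, hj⟩ := xyExp_injective hsum
      refine ⟨((Finsupp.equivFunOnFinite.symm fun m : Fin e => u (1, m),
        Finsupp.equivFunOnFinite.symm fun m : Fin e => v (1, m)),
        (Finsupp.equivFunOnFinite.symm fun m : Fin e => u (0, m),
        Finsupp.equivFunOnFinite.symm fun m : Fin e => v (0, m))), ?_, ?_⟩
      · simp only [Finset.mem_product, Finset.HasAntidiagonal.mem_antidiagonal]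
        exact ⟨DFunLike.coe_injective hj.symm, DFunLike.coe_injective hi.symm⟩
      · exact Prod.ext hu.symm hv.symm
    · rintro ⟨⟨j1, j2⟩, ⟨i1, i2⟩⟩ _
      rfl

variable {p : ℕ} [Fact p.Prime]

/-- The Witt group law in characteristic `p`, as a family of power series. -/
def wittSeries (p : ℕ) [Fact p.Prime] (e : ℕ) (F : Type*) [CommRing F] [CharP F p] (m : Fin e) :
    MvPowerSeries (Fin 2 × ℕ) F :=
  MvPolynomial.map (ZMod.castHom dvd_rfl F) (wittHmod p m)

theorem hasSubst_wittSeries (F : Type*) [CommRing F] [CharP F p] :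
    HasSubst (wittSeries p e F) := by
  refine hasSubst_of_constantCoeff_zero fun m => ?_
  rw [wittSeries, ← MvPowerSeries.coeff_zero_eq_constantCoeff_apply, MvPolynomial.coeff_coe,
    ← MvPolynomial.constantCoeff_eq, MvPolynomial.constantCoeff_map, wittHmod,
    MvPolynomial.constantCoeff_map, WittVector.constantCoeff_wittAdd, map_zero, map_zero]

theorem coeff_wittSeries_prod (F : Type*) [CommRing F] [CharP F p] (i j : Fin e → ℕ)
    (l : Fin e →₀ ℕ) :
    coeff (xyExp e i j) (l.prod fun m n => wittSeries p e F m ^ n) =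
      ZMod.cast (wittAlpha p e i j l) := by
  have : (l.prod fun m n => wittSeries p e F m ^ n) =
      ((MvPolynomial.map (ZMod.castHom dvd_rfl F) (∏ m : Fin e, wittHmod p m ^ l m) :
        MvPolynomial (Fin 2 × ℕ) F) : MvPowerSeries (Fin 2 × ℕ) F) := by
    rw [Finsupp.prod_fintype _ _ fun _ => pow_zero _, map_prod]
    simp only [← MvPolynomial.coeToMvPowerSeries.ringHom_apply, map_prod, map_pow]
    rfl
  rw [this, MvPolynomial.coeff_coe, MvPolynomial.coeff_map]
  rfl

/-- A series expansion which is iterative for the Witt group law. -/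
structure IsWittExpansion (p : ℕ) [Fact p.Prime] {e : ℕ} {F : Type*} [Field F]
    (φ : F →+* MvPowerSeries (Fin e) F) : Prop where
  constantCoeff : ∀ x, MvPowerSeries.constantCoeff (φ x) = x
  coeff_coeff : ∀ (i j : Fin e →₀ ℕ) x, coeff i (φ (coeff j (φ x))) =
    ∑ᶠ l : Fin e →₀ ℕ, ZMod.cast (wittAlpha p e i j l) * coeff l (φ x)

/-- Substitution of the Witt group law in a series expansion. -/
def wittSubst (p : ℕ) [Fact p.Prime] {e : ℕ} {F : Type*} [Field F] [CharP F p]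
    (φ : F →+* MvPowerSeries (Fin e) F) :
    F →+* MvPowerSeries (Fin e) (MvPowerSeries (Fin e) F) :=
  (xySeries e F).comp
    ((substAlgHom (R := F) (hasSubst_wittSeries (p := p) (e := e) F)).toRingHom.comp φ)

theorem coeff_wittSubst {F : Type*} [Field F] [CharP F p] (φ : F →+* MvPowerSeries (Fin e) F)
    (i j : Fin e →₀ ℕ) (x : F) : coeff i (coeff j (wittSubst p φ x)) =
      ∑ᶠ l : Fin e →₀ ℕ, ZMod.cast (wittAlpha p e i j l) * coeff l (φ x) := by
  change coeff (xyExp e i j) (substAlgHom (R := F) (hasSubst_wittSeries (p := p) F) (φ x)) = _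
  rw [substAlgHom_apply, coeff_subst (hasSubst_wittSeries F)]
  refine finsum_congr fun l => ?_
  rw [coeff_wittSeries_prod, smul_eq_mul, mul_comm]

theorem wittSubst_support_finite {F : Type*} [Field F] [CharP F p]
    (φ : F →+* MvPowerSeries (Fin e) F) (i j : Fin e →₀ ℕ) (x : F) :
    (Function.support fun l : Fin e →₀ ℕ =>
      (ZMod.cast (wittAlpha p e i j l) * coeff l (φ x) : F)).Finite := by
  refine (coeff_subst_finite (hasSubst_wittSeries (p := p) (e := e) F) (φ x)
    (xyExp e i j)).subset fun l => ?_
  simp only [Function.mem_support]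
  rw [coeff_wittSeries_prod, smul_eq_mul, mul_comm]
  exact id

theorem map_comp_eq_wittSubst_of_hom {K F : Type*} [Field K] [Field F] [CharP K p] [CharP F p]
    {φ : K →+* MvPowerSeries (Fin e) K} (h : IsWittExpansion p φ)
    {Φ : F →+* MvPowerSeries (Fin e) F} (ι : K →+* F) (hι : ∀ x, Φ (ι x) = map ι (φ x)) :
    ((map Φ).comp Φ).comp ι = (wittSubst p Φ).comp ι := by
  refine RingHom.ext fun x => MvPowerSeries.ext fun j => MvPowerSeries.ext fun i => ?_
  simp only [RingHom.comp_apply]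
  rw [coeff_wittSubst, coeff_map, hι, coeff_map, hι, coeff_map, h.coeff_coeff]
  simp only [coeff_map]
  refine ((ι : K →+ F).map_finsum (wittSubst_support_finite φ i j x)).trans ?_
  refine finsum_congr fun l => (map_mul ι _ _).trans ?_
  congr 1
  exact (RingHom.congr_fun
    (Subsingleton.elim (ι.comp (ZMod.castHom dvd_rfl K)) (ZMod.castHom dvd_rfl F)) _)

/-- The amalgam of two iterative expansions is iterative. -/
theorem exists_wittExpansion_amalgam {S K K' : Type} [CommRing S] [IsDomain S] [Field K] [Field K']
    [CharP K p] [CharP K' p]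
    (g : S →+* K) (g' : S →+* K') (hg : Function.Injective g) (hg' : Function.Injective g')
    {φ : K →+* MvPowerSeries (Fin e) K} (hφ : IsWittExpansion p φ)
    {φ' : K' →+* MvPowerSeries (Fin e) K'} (hφ' : IsWittExpansion p φ')
    (hS : ∀ s n, ∃ t, coeff n (φ (g s)) = g t ∧ coeff n (φ' (g' s)) = g' t) :
    ∃ (F : Type) (_ : Field F) (ι : K →+* F) (ι' : K' →+* F) (Φ : F →+* MvPowerSeries (Fin e) F),
      (∀ s, ι (g s) = ι' (g' s)) ∧ (∀ x, Φ (ι x) = map ι (φ x)) ∧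
      (∀ x, Φ (ι' x) = map ι' (φ' x)) ∧ IsWittExpansion p Φ := by
  obtain ⟨F, _, ι, ι', Φ, hιι', hι, hι', hΦ, hext⟩ :=
    exists_amalgam g g' hg hg' φ hφ.constantCoeff φ' hφ'.constantCoeff hS
  have : CharP F p := charP_of_injective_ringHom ι.injective p
  refine ⟨F, inferInstance, ι, ι', Φ, hιι', hι, hι', hΦ, fun i j x => ?_⟩
  have := hext _ _ _ (map_comp_eq_wittSubst_of_hom hφ ι hι) (map_comp_eq_wittSubst_of_hom hφ' ι' hι')
  rw [← coeff_wittSubst, ← this, RingHom.comp_apply, coeff_map]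

end Iterativity

section Derivations

open MvPowerSeries

variable {e : ℕ} {p : ℕ} [Fact p.Prime]

/-- The coefficients of a series expansion along one variable form a Hasse derivation. -/
theorem isHasse_coeff_single {F : Type*} [Field F] {φ : F →+* MvPowerSeries (Fin e) F}
    (hφ : ∀ x, MvPowerSeries.constantCoeff (φ x) = x) (a : Fin e) :
    IsHasse fun n x => coeff (Finsupp.single a n) (φ x) where
  zero_apply x := by simp [hφ]
  map_add n x y := by simp
  map_mul n x y := by
    classical
    rw [map_mul, MvPowerSeries.coeff_mul, Finsupp.antidiagonal_single, Finset.sum_map,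
      Finset.Nat.sum_antidiagonal_eq_sum_range_succ_mk]
    rfl

theorem coeff_wittHmod_pow_mul {q n : ℕ} (hq : q = p ^ n) (m : ℕ)
    (G : MvPolynomial (Fin 2 × ℕ) (ZMod p)) (x : Fin 2 × ℕ →₀ ℕ) (hx : ∀ a, x a < q) :
    MvPolynomial.coeff x (wittHmod p m ^ q * G) = 0 := by
  have hsum : wittHmod p m ^ q = ∑ u ∈ (wittHmod p m).support,
      MvPolynomial.monomial (q • u) ((wittHmod p m).coeff u ^ q) := by
    conv_lhs => rw [MvPolynomial.as_sum (wittHmod p m)]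
    rw [hq, sum_pow_char_pow]
    exact Finset.sum_congr rfl fun u _ => MvPolynomial.monomial_pow
  rw [hsum, Finset.sum_mul, MvPolynomial.coeff_sum]
  refine Finset.sum_eq_zero fun u hu => ?_
  rw [MvPolynomial.coeff_monomial_mul', if_neg]
  intro hle
  have hu0 : u ≠ 0 := by
    rintro rfl
    rw [MvPolynomial.mem_support_iff, ← MvPolynomial.constantCoeff_eq, wittHmod,
      MvPolynomial.constantCoeff_map, WittVector.constantCoeff_wittAdd, map_zero] at hu
    exact hu rfl
  obtain ⟨a, ha⟩ := Finsupp.ne_iff.1 hu0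
  have h1 := hle a
  have h2 := hx a
  rw [Finsupp.smul_apply, smul_eq_mul] at h1
  have h3 : 1 ≤ u a := Nat.one_le_iff_ne_zero.2 ha
  nlinarith

theorem wittAlpha_eq_zero {n : ℕ} {i j l : Fin e → ℕ} (hi : ∀ m, i m < p ^ n)
    (hj : ∀ m, j m < p ^ n) {m : Fin e} (hl : p ^ n ≤ l m) : wittAlpha p e i j l = 0 := by
  classical
  rw [wittAlpha, ← Finset.mul_prod_erase _ _ (Finset.mem_univ m), ← Nat.add_sub_cancel' hl,
    pow_add, mul_assoc]
  refine coeff_wittHmod_pow_mul rfl _ _ _ fun a => ?_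
  obtain ⟨a, k⟩ := a
  rw [xyExp_apply]
  have hp : 0 < p ^ n := pow_pos (Fact.out (p := p.Prime)).pos n
  split_ifs
  exacts [hi _, hj _, hp]

theorem finsum_wittAlpha {F : Type*} [Field F] [CharP F p] (n : ℕ) {i j : Fin e → ℕ}
    (hi : ∀ m, i m < p ^ n) (hj : ∀ m, j m < p ^ n) (f : (Fin e →₀ ℕ) → F) :
    ∑ᶠ l : Fin e →₀ ℕ, ZMod.cast (wittAlpha p e i j l) * f l =
      ∑ ω : Fin e → Fin (p ^ n), ZMod.cast (wittAlpha p e i j fun m => ω m) *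
        f (Finsupp.equivFunOnFinite.symm fun m => ω m) := by
  let emb : (Fin e → Fin (p ^ n)) ↪ (Fin e →₀ ℕ) :=
    ⟨fun ω => Finsupp.equivFunOnFinite.symm fun m => (ω m : ℕ), fun ω ω' h => by
      funext m
      exact Fin.ext (congrFun (Finsupp.equivFunOnFinite.symm.injective h) m)⟩
  rw [finsum_eq_sum_of_support_subset (s := Finset.univ.map emb), Finset.sum_map]
  · rfl
  · intro l hl
    rw [Finset.mem_coe, Finset.mem_map]
    have hbox : ∀ m, l m < p ^ n := by
      intro m
      by_contra hm
      refine hl ?_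
      beta_reduce
      rw [wittAlpha_eq_zero hi hj (not_lt.1 hm)]
      simp
    exact ⟨fun m => ⟨l m, hbox m⟩, Finset.mem_univ _, by ext m; rfl⟩

/-- In a field with an iterative expansion for the Witt group law, families which are independent
over the constants of level `n` have at most `p ^ (n * e)` elements. -/
theorem IsWittExpansion.card_le {F : Type*} [Field F] [CharP F p]
    {φ : F →+* MvPowerSeries (Fin e) F} (h : IsWittExpansion p φ) (a : Fin e) (n : ℕ)
    {ι : Type*} [Fintype ι] (x : ι → F)
    (hx : ∀ c : ι → F, (∀ i, c i ∈ (isHasse_coeff_single h.constantCoeff a).constants (p ^ n)) →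
      ∑ i, c i * x i = 0 → c = 0) : Fintype.card ι ≤ (p ^ n) ^ e := by
  have hp : 0 < p ^ n := pow_pos (Fact.out (p := p.Prime)).pos n
  have := (isHasse_coeff_single h.constantCoeff a).card_le_of_constants_independent
    (Ω := Fin e → Fin (p ^ n)) (p ^ n)
    (fun ω x => coeff (Finsupp.equivFunOnFinite.symm fun m => (ω m : ℕ)) (φ x))
    (fun _ => ⟨0, hp⟩) (fun x => ?_) (fun j hj ω => ⟨fun ω' => ZMod.cast (wittAlpha p e
      (Finsupp.single a j) (fun m => ω m) fun m => ω' m), fun x => ?_⟩) x hx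
  · simpa using this
  · refine Eq.trans ?_ (h.constantCoeff x)
    rw [← MvPowerSeries.coeff_zero_eq_constantCoeff_apply]
    congr 2
    exact Finsupp.ext fun _ => rfl
  · rw [h.coeff_coeff]
    refine finsum_wittAlpha n (fun m => ?_) (fun m => (ω m).2) _
    rw [Finsupp.single_apply]
    split_ifs
    exacts [hj, hp]

end Derivations

section Iterates

theorem sum_pow_char_of_commute {R ι : Type*} [Semiring R] (p : ℕ) [Fact p.Prime] [CharP R p]
    (s : Finset ι) (a : ι → R) (h : ∀ i j, Commute (a i) (a j)) :
    (∑ i ∈ s, a i) ^ p = ∑ i ∈ s, a i ^ p := by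
  classical
  induction s using Finset.induction_on with
  | empty => simp [(Fact.out (p := p.Prime)).ne_zero]
  | insert i s hi ih =>
    rw [Finset.sum_insert hi, Finset.sum_insert hi, add_pow_char_of_commute, ih]
    exact Commute.sum_right _ _ _ fun j _ => h i j

variable {F : Type*} [Field F] {D : ℕ → F → F}

theorem IsHasse.iterate_char (h : IsHasse D) (hc : ∀ i j x, D i (D j x) = D j (D i x))
    (p : ℕ) [Fact p.Prime] [CharP F p] : IsHasse fun n => (D n)^[p] where
  zero_apply x := Function.iterate_fixed (h.zero_apply x) p
  map_add n x y := iterate_map_add (⟨⟨D n, h.map_zero n⟩, h.map_add n⟩ : F →+ F) p x y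
  map_mul n x y := by
    let W := F → F → F
    let L : ℕ → Module.End F W := fun k =>
      { toFun := fun G x y => G (D k x) y
        map_add' := fun _ _ => rfl
        map_smul' := fun _ _ => rfl }
    let R : ℕ → Module.End F W := fun k =>
      { toFun := fun G x y => G x (D k y)
        map_add' := fun _ _ => rfl
        map_smul' := fun _ _ => rfl }
    have hL : ∀ k i (G : W) x y, (L k ^ i) G x y = G ((D k)^[i] x) y := by
      intro k i
      induction i with
      | zero => intros; rfl
      | succ i ih =>
        intro G x y
        rw [pow_succ', Module.End.mul_apply]
        exact ih G (D k x) y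
    have hR : ∀ k i (G : W) x y, (R k ^ i) G x y = G x ((D k)^[i] y) := by
      intro k i
      induction i with
      | zero => intros; rfl
      | succ i ih =>
        intro G x y
        rw [pow_succ', Module.End.mul_apply]
        exact ih G x (D k y)
    have hLR : ∀ i j, Commute (L i) (R j) := fun i j => rfl
    have hLL : ∀ i j, Commute (L i) (L j) := fun i j => by
      refine LinearMap.ext fun G => ?_
      funext x y
      exact congrArg (fun z => G z y) (hc j i x)
    have hRR : ∀ i j, Commute (R i) (R j) := fun i j => by
      refine LinearMap.ext fun G => ?_
      funext x y
      exact congrArg (fun z => G x z) (hc j i y)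
    let T : Module.End F W := ∑ k ∈ Finset.range (n + 1), L k * R (n - k)
    have : CharP (Module.End F W) p :=
      charP_of_injective_algebraMap (algebraMap F (Module.End F W)).injective p
    have hT : T ^ p = ∑ k ∈ Finset.range (n + 1), L k ^ p * R (n - k) ^ p := by
      rw [sum_pow_char_of_commute]
      · exact Finset.sum_congr rfl fun k _ => (hLR _ _).mul_pow p
      · exact fun i j => ((hLL i j).mul_right (hLR i _)).mul_left
          (((hLR j _).symm).mul_right (hRR _ _))
    have hsum : ∀ (s : Finset ℕ) (f : ℕ → F → F → F) x y,
        (∑ k ∈ s, f k) x y = ∑ k ∈ s, f k x y := by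
      intro s f x y
      rw [Finset.sum_apply, Finset.sum_apply]
    have hTapp : ∀ (G : W) x y, T G x y = ∑ k ∈ Finset.range (n + 1), G (D k x) (D (n - k) y) := by
      intro G x y
      simp only [T, LinearMap.sum_apply]
      exact hsum _ _ _ _
    have hpost : ∀ i (G : W), (fun x y => D n ((T ^ i) G x y) : W) =
        (T ^ i) fun x y => D n (G x y) := by
      intro i
      induction i with
      | zero => intros; rfl
      | succ i ih =>
        intro G
        rw [pow_succ, Module.End.mul_apply, Module.End.mul_apply, ih]
        congr 1
        funext x y
        rw [hTapp, hTapp, h.map_sum]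
    have hmul : ∀ i, (fun x y => (D n)^[i] (x * y) : W) = (T ^ i) fun x y => x * y := by
      intro i
      induction i with
      | zero => rfl
      | succ i ih =>
        simp only [Function.iterate_succ_apply']
        have hT1 : T (fun x y => x * y) = fun x y => D n (x * y) := by
          funext x y
          rw [hTapp, h.map_mul]
        rw [pow_succ, Module.End.mul_apply, hT1, ← hpost, ← ih]
    refine (congrFun₂ (hmul p) x y).trans ?_
    rw [hT, LinearMap.sum_apply]
    refine (hsum _ _ _ _).trans ?_
    refine Finset.sum_congr rfl fun k _ => ?_
    rw [Module.End.mul_apply, hL, hR]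

theorem IsHasse.iterate_char_pow (h : IsHasse D) (hc : ∀ i j x, D i (D j x) = D j (D i x))
    (p : ℕ) [Fact p.Prime] [CharP F p] (m : ℕ) : IsHasse fun n => (D n)^[p ^ m] := by
  induction m with
  | zero => simpa using h
  | succ m ih =>
    have := ih.iterate_char (fun i j x =>
      (Function.Commute.iterate_iterate (f := D i) (g := D j) (hc i j) (p ^ m) (p ^ m)) x) p
    simpa only [← Function.iterate_mul, ← pow_succ] using this

/-- The composition of members of several families of operators. -/
def compAlong {e : ℕ} {α : Type*} (T : Fin e → ℕ → α → α) (v : Fin e → ℕ) : α → α :=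
  (List.ofFn fun m => T m (v m)).foldr (· ∘ ·) id

theorem compAlong_succ {e : ℕ} {α : Type*} (T : Fin (e + 1) → ℕ → α → α) (v : Fin (e + 1) → ℕ)
    (x : α) : compAlong T v x =
      T 0 (v 0) (compAlong (fun m => T m.succ) (fun m => v m.succ) x) := by
  simp [compAlong, List.ofFn_succ]

theorem compAlong_zero {e : ℕ} {α : Type*} {T : Fin e → ℕ → α → α} (hT : ∀ m x, T m 0 x = x)
    (x : α) : compAlong T 0 x = x := by
  induction e with
  | zero => simp [compAlong]
  | succ e ih =>
    rw [compAlong_succ, Pi.zero_apply, hT]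
    exact ih fun m => hT m.succ

theorem compAlong_add {e : ℕ} {T : Fin e → ℕ → F → F} (hT : ∀ m, IsHasse (T m))
    (v : Fin e → ℕ) (x y : F) : compAlong T v (x + y) = compAlong T v x + compAlong T v y := by
  induction e with
  | zero => simp [compAlong]
  | succ e ih =>
    rw [compAlong_succ, ih fun m => hT m.succ, (hT 0).map_add, compAlong_succ, compAlong_succ]

theorem compAlong_mul {e : ℕ} {T : Fin e → ℕ → F → F} (hT : ∀ m, IsHasse (T m))
    (v : Fin e →₀ ℕ) (x y : F) : compAlong T v (x * y) =
      ∑ q ∈ Finset.HasAntidiagonal.antidiagonal v, compAlong T q.1 x * compAlong T q.2 y := by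
  classical
  induction e with
  | zero =>
    have : v = 0 := Subsingleton.elim _ _
    subst this
    simp [compAlong]
  | succ e ih =>
    have hsucc : ∀ w : Fin (e + 1) →₀ ℕ, (fun m => w m.succ : Fin e → ℕ) = w.tail := fun w => rfl
    rw [compAlong_succ, hsucc, ih fun m => hT m.succ, (hT 0).map_sum]
    simp only [(hT 0).map_mul]
    have hrange : ∀ a b : F, ∑ k ∈ Finset.range (v 0 + 1), T 0 k a * T 0 (v 0 - k) b =
        ∑ r ∈ Finset.HasAntidiagonal.antidiagonal (v 0), T 0 r.1 a * T 0 r.2 b := fun a b =>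
      (Finset.Nat.sum_antidiagonal_eq_sum_range_succ_mk (fun r => T 0 r.1 a * T 0 r.2 b) _).symm
    simp only [hrange]
    rw [← Finset.sum_product']
    refine Finset.sum_bij
      (fun q _ => (Finsupp.cons q.2.1 q.1.1, Finsupp.cons q.2.2 q.1.2)) ?_ ?_ ?_ ?_
    · rintro ⟨⟨a, b⟩, ⟨i, j⟩⟩ hq
      simp only [Finset.mem_product, Finset.HasAntidiagonal.mem_antidiagonal] at hq ⊢
      ext m
      refine Fin.cases ?_ (fun m => ?_) m
      · simpa using hq.2
      · simpa [Finsupp.tail_apply] using DFunLike.congr_fun hq.1 m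
    · rintro ⟨⟨a, b⟩, ⟨i, j⟩⟩ _ ⟨⟨a', b'⟩, ⟨i', j'⟩⟩ _ heq
      simp only [Prod.mk.injEq] at heq ⊢
      obtain ⟨h1, h2⟩ := Finsupp.cons_injective2 heq.1
      obtain ⟨h3, h4⟩ := Finsupp.cons_injective2 heq.2
      exact ⟨⟨h2, h4⟩, h1, h3⟩
    · rintro ⟨a, b⟩ hab
      rw [Finset.HasAntidiagonal.mem_antidiagonal] at hab
      refine ⟨((a.tail, b.tail), (a 0, b 0)), ?_, by simp⟩
      simp only [Finset.mem_product, Finset.HasAntidiagonal.mem_antidiagonal]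
      rw [← hab]
      exact ⟨Finsupp.ext fun _ => rfl, rfl⟩
    · rintro ⟨⟨a, b⟩, ⟨i, j⟩⟩ _
      rw [compAlong_succ, compAlong_succ, hsucc, hsucc, Finsupp.tail_cons, Finsupp.tail_cons,
        Finsupp.cons_zero, Finsupp.cons_zero]

/-- The generating series of the compositions of several Hasse derivations. -/
theorem exists_series_of_isHasse {e : ℕ} {T : Fin e → ℕ → F → F} (hT : ∀ m, IsHasse (T m)) :
    ∃ φ : F →+* MvPowerSeries (Fin e) F, ∀ (v : Fin e →₀ ℕ) x,
      MvPowerSeries.coeff v (φ x) = compAlong T v x := by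
  classical
  let φ : F → MvPowerSeries (Fin e) F := fun x v => compAlong T v x
  have hφ : ∀ (v : Fin e →₀ ℕ) x, MvPowerSeries.coeff v (φ x) = compAlong T v x := fun _ _ => rfl
  have hadd : ∀ x y, φ (x + y) = φ x + φ y := fun x y => by
    ext v
    rw [map_add, hφ, hφ, hφ, compAlong_add hT]
  have hmul : ∀ x y, φ (x * y) = φ x * φ y := fun x y => by
    ext v
    rw [MvPowerSeries.coeff_mul, hφ, compAlong_mul hT]
    rfl
  have hone : φ 1 = 1 := by
    have h1 : φ 1 * φ 1 = φ 1 := by rw [← hmul, one_mul]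
    have h2 : φ 1 ≠ 0 := fun h => by
      have := congrArg (MvPowerSeries.coeff 0) h
      rw [hφ, map_zero, Finsupp.coe_zero, compAlong_zero fun m => (hT m).zero_apply] at this
      exact one_ne_zero this
    exact mul_left_cancel₀ h2 (h1.trans (mul_one _).symm)
  let Φ : F →+* MvPowerSeries (Fin e) F :=
    { toFun := φ
      map_one' := hone
      map_mul' := hmul
      map_add' := hadd
      map_zero' := by simpa using hadd 0 0 }
  exact ⟨Φ, hφ⟩

theorem hsComp_single {p e : ℕ} (h : IsHasse D) (he : 0 < e) (n : ℕ) (x : F) :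
    hsComp p e D (Finsupp.single (⟨0, he⟩ : Fin e) n) x = D n x := by
  obtain ⟨e, rfl⟩ := Nat.exists_eq_succ_of_ne_zero he.ne'
  change compAlong (fun (m : Fin (e + 1)) n => (D n)^[p ^ (m : ℕ)])
    (Finsupp.single (0 : Fin (e + 1)) n) x = _
  have h0 : (fun m : Fin e => Finsupp.single (0 : Fin (e + 1)) n m.succ) = 0 := by
    funext m
    simp
  rw [compAlong_succ, h0, compAlong_zero]
  · simp
  · exact fun m x => Function.iterate_fixed (h.zero_apply x) _

/-- The expansion attached to an iterative Hasse derivation for the Witt group law. -/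
theorem exists_wittExpansion {p e : ℕ} [Fact p.Prime] [CharP F p] (he : 0 < e) (h : IsHasse D)
    (hc : ∀ i j x, D i (D j x) = D j (D i x))
    (hw : ∀ i j : Fin e → ℕ, ∀ x : F, hsComp p e D i (hsComp p e D j x) =
        ∑ᶠ l : Fin e → ℕ, ZMod.cast (wittAlpha p e i j l) * hsComp p e D l x) :
    ∃ φ : F →+* MvPowerSeries (Fin e) F, IsWittExpansion p φ ∧
      (∀ v x, MvPowerSeries.coeff v (φ x) = hsComp p e D v x) ∧
      ∀ n x, MvPowerSeries.coeff (Finsupp.single (⟨0, he⟩ : Fin e) n) (φ x) = D n x := by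
  obtain ⟨φ, hφ⟩ := exists_series_of_isHasse (fun m : Fin e => h.iterate_char_pow hc p m)
  have hφ' : ∀ v x, MvPowerSeries.coeff v (φ x) = hsComp p e D v x := hφ
  refine ⟨φ, ⟨fun x => ?_, fun i j x => ?_⟩, hφ', fun n x => ?_⟩
  · rw [← MvPowerSeries.coeff_zero_eq_constantCoeff_apply, hφ]
    exact compAlong_zero (T := fun (m : Fin e) n => (D n)^[p ^ (m : ℕ)])
      (fun m y => Function.iterate_fixed (h.zero_apply y) _) x
  · simp only [hφ', hw]
    exact (finsum_comp_equiv (Finsupp.equivFunOnFinite : (Fin e →₀ ℕ) ≃ (Fin e → ℕ))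
      (f := fun l => (ZMod.cast (wittAlpha p e i j l) * hsComp p e D l x : F))).symm
  · rw [hφ', hsComp_single h]

end Iterates

theorem IsHasse.iterate_one_independent {F : Type*} [Field F] {D : ℕ → F → F} {p : ℕ}
    [Fact p.Prime] (h : IsHasse D) {d : ℕ} {x : F}
    (hx : (D 1)^[d] x ≠ 0) (hD : ∀ y, (D 1)^[d + 1] y = 0) (c : Fin (d + 1) → F)
    (hc : ∀ i, c i ∈ h.constants p) (hs : ∑ i, c i * (D 1)^[i] x = 0) : c = 0 := by
  have h1 : 1 < p := (Fact.out (p := p.Prime)).one_lt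
  have hiter : ∀ (k : ℕ) (c y : F), c ∈ h.constants p → (D 1)^[k] (c * y) = c * (D 1)^[k] y := by
    intro k
    induction k with
    | zero => intros; rfl
    | succ k ih =>
      intro c y hc
      rw [Function.iterate_succ_apply, h.map_constants_mul h1 hc, ih _ _ hc,
        Function.iterate_succ_apply]
  have hz : ∀ k : ℕ, (D 1)^[k] 0 = 0 := fun k => Function.iterate_fixed (h.map_zero 1) k
  have key : ∀ k (hk : k < d + 1), c ⟨k, hk⟩ = 0 := by
    intro k
    induction k using Nat.strong_induction_on with
    | _ k ih =>
      intro hk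
      have h2 := congrArg (D 1)^[d - k] hs
      rw [hz] at h2
      have h3 : (D 1)^[d - k] (∑ i, c i * (D 1)^[i] x) =
          ∑ i, c i * (D 1)^[d - k + i] x := by
        have := _root_.map_sum ((show AddMonoid.End F from ⟨⟨D 1, h.map_zero 1⟩, h.map_add 1⟩) ^ (d - k))
          (fun i => c i * (D 1)^[i] x) Finset.univ
        rw [AddMonoid.End.coe_pow] at this
        refine this.trans (Finset.sum_congr rfl fun i _ => ?_)
        refine (hiter _ _ _ (hc i)).trans ?_
        rw [Function.iterate_add_apply]
      rw [h3, Finset.sum_eq_single ⟨k, hk⟩] at h2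
      · rw [Nat.sub_add_cancel (Nat.lt_succ_iff.1 hk)] at h2
        exact (mul_eq_zero.1 h2).resolve_right hx
      · intro i _ hik
        rcases lt_or_gt_of_ne (fun h => hik (Fin.ext h) : (i : ℕ) ≠ k) with hlt | hgt
        · rw [show c i = 0 from ih i hlt i.2, zero_mul]
        · have : d - k + i = (d - k + i - (d + 1)) + (d + 1) := by omega
          rw [this, Function.iterate_add_apply, hD, hz, mul_zero]
      · simp
  funext i
  exact key i i.2

section Basis

variable {F : Type*} [Field F] {D : ℕ → F → F} {p : ℕ} [Fact p.Prime] [CharP F p]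

theorem IsHasse.apply_pow_char (h : IsHasse D) (n : ℕ) (y : F) :
    D n (y ^ p) = if p ∣ n then D (n / p) y ^ p else 0 := by
  have hp : p ≠ 0 := (Fact.out (p := p.Prime)).ne_zero
  obtain ⟨φ, hφ⟩ := exists_series_of_isHasse (e := 1) (T := fun _ => D) fun _ => h
  have hφ' : ∀ n x, MvPowerSeries.coeff (Finsupp.single 0 n) (φ x) = D n x := by
    intro n x
    rw [hφ, compAlong_succ]
    simp [compAlong]
  rw [← hφ', map_pow, ← MvPowerSeries.map_frobenius_expand p hp, MvPowerSeries.coeff_map]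
  split_ifs with hn
  · obtain ⟨m, rfl⟩ := hn
    rw [Nat.mul_div_cancel_left _ (Nat.pos_of_ne_zero hp), ← smul_eq_mul, ← Finsupp.smul_single,
      MvPowerSeries.coeff_expand_smul, hφ', frobenius_def]
  · rw [MvPowerSeries.coeff_expand_of_not_dvd (i := 0), _root_.map_zero]
    simpa using hn

theorem IsHasse.pow_mem_constants (h : IsHasse D) (n : ℕ) (y : F) :
    y ^ p ^ n ∈ h.constants (p ^ n) := by
  induction n with
  | zero =>
    intro j hj hj1
    rw [pow_zero] at hj1
    omega
  | succ n ih =>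
    intro j hj hjn
    rw [pow_succ, pow_mul, h.apply_pow_char]
    split_ifs with hd
    · obtain ⟨m, rfl⟩ := hd
      have hp := (Fact.out (p := p.Prime)).pos
      rw [Nat.mul_div_cancel_left _ hp, ih m, zero_pow hp.ne']
      · exact Nat.pos_of_mul_pos_left hj
      · rw [pow_succ'] at hjn
        exact Nat.lt_of_mul_lt_mul_left hjn
    · rfl

theorem IsHasse.exists_eq_pow_of_mem_constants (h : IsHasse D)
    (h1 : ∀ x, D 1 x = 0 → ∃ y, x = y ^ p) (n : ℕ) (x : F) (hx : x ∈ h.constants (p ^ n)) :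
    ∃ y, x = y ^ p ^ n := by
  have hp := Fact.out (p := p.Prime)
  induction n generalizing x with
  | zero => exact ⟨x, by simp⟩
  | succ n ih =>
    obtain ⟨y, rfl⟩ := h1 x (hx 1 one_pos (Nat.one_lt_pow n.succ_ne_zero hp.one_lt))
    obtain ⟨z, rfl⟩ := ih y fun j hj hjn => by
      have := hx (p * j) (Nat.mul_pos hp.pos hj)
        (by rw [pow_succ']; exact Nat.mul_lt_mul_of_pos_left hjn hp.pos)
      rw [h.apply_pow_char, if_pos (dvd_mul_right p j), Nat.mul_div_cancel_left _ hp.pos] at this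
      exact eq_zero_of_pow_eq_zero this
    exact ⟨z, by rw [← pow_mul, pow_succ]⟩

/-- A field with enough Hasse derivatives has a large family which is independent over the
constants of level `n`. -/
theorem IsHasse.exists_independent (h : IsHasse D) (h1 : ∀ x, D 1 x = 0 → ∃ y, x = y ^ p)
    {d : ℕ} {x : F} (hx : (D 1)^[d] x ≠ 0) (hD : ∀ y, (D 1)^[d + 1] y = 0) (n : ℕ) :
    ∃ (B : Type) (_ : Fintype B) (b : B → F), Fintype.card B = (d + 1) ^ n ∧
      ∀ c : B → F, (∀ i, c i ∈ h.constants (p ^ n)) → ∑ i, c i * b i = 0 → c = 0 := by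
  induction n with
  | zero =>
    refine ⟨Unit, inferInstance, fun _ => 1, by simp, fun c _ hs => ?_⟩
    funext i
    simpa using hs
  | succ n ih =>
    obtain ⟨B, _, b, hcard, hb⟩ := ih
    refine ⟨Fin (d + 1) × B, inferInstance, fun q => (D 1)^[q.1] x * b q.2 ^ p, ?_, ?_⟩
    · rw [Fintype.card_prod, hcard, Fintype.card_fin, pow_succ']
    · intro c hc hs
      choose y hy using fun q => h.exists_eq_pow_of_mem_constants h1 (n + 1) (c q) (hc q)
      have hu : ∀ i, ∑ j, c (i, j) * b j ^ p = (∑ j, y (i, j) ^ p ^ n * b j) ^ p := by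
        intro i
        rw [sum_pow_char]
        refine Finset.sum_congr rfl fun j _ => ?_
        rw [mul_pow, ← pow_mul, ← pow_succ, ← hy]
      have hzero := h.iterate_one_independent (p := p) hx hD
        (fun i => ∑ j, c (i, j) * b j ^ p) (fun i => ?_) ?_
      · funext ⟨i, j⟩
        have h2 : (∑ j, y (i, j) ^ p ^ n * b j) ^ p = 0 := (hu i).symm.trans (congrFun hzero i)
        have h3 := congrFun (hb _ (fun j => h.pow_mem_constants n _) (eq_zero_of_pow_eq_zero h2)) j
        rw [hy, eq_zero_of_pow_eq_zero h3]
        exact zero_pow (pow_pos (Fact.out (p := p.Prime)).pos _).ne'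
      · rw [hu]
        simpa using h.pow_mem_constants 1 (∑ j, y (i, j) ^ p ^ n * b j)
      · rw [← hs, Fintype.sum_prod_type]
        refine Finset.sum_congr rfl fun i _ => ?_
        rw [Finset.sum_mul]
        exact Finset.sum_congr rfl fun j _ => by ring

theorem IsWittExpansion.exists_constants_combination {e : ℕ}
    {φ : F →+* MvPowerSeries (Fin e) F} (h : IsWittExpansion p φ) (a : Fin e) (n : ℕ)
    {B : Type*} [Fintype B] (hB : Fintype.card B = (p ^ n) ^ e) (b : B → F)
    (hb : ∀ c : B → F, (∀ i, c i ∈ (isHasse_coeff_single h.constantCoeff a).constants (p ^ n)) →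
      ∑ i, c i * b i = 0 → c = 0) (z : F) :
    ∃ c : B → F, (∀ i, c i ∈ (isHasse_coeff_single h.constantCoeff a).constants (p ^ n)) ∧
      z = ∑ i, c i * b i := by
  refine (isHasse_coeff_single h.constantCoeff a).exists_constants_combination (p ^ n) ?_ b hb z
  intro x
  by_contra hcon
  push Not at hcon
  have := h.card_le a n x hcon
  rw [Fintype.card_option] at this
  omega

end Basis

section TermEval

variable {R : Type*} [CommRing R]

/-- The operation attached to a symbol of `shfLang` by a family of unary operators on a ring. -/
def shfOp (D : ℕ → R → R) : {n : ℕ} → shfLang.Functions n → (Fin n → R) → R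
  | _, Sum.inl ringFunc.add, x => x 0 + x 1
  | _, Sum.inl ringFunc.mul, x => x 0 * x 1
  | _, Sum.inl ringFunc.neg, x => -x 0
  | _, Sum.inl ringFunc.zero, _ => 0
  | _, Sum.inl ringFunc.one, _ => 1
  | 0, Sum.inr f, _ => Empty.elim f
  | 1, Sum.inr (n : ℕ), x => D n (x 0)
  | _ + 2, Sum.inr f, _ => Empty.elim f

/-- The value of a term of `shfLang` in a ring with a family of unary operators. -/
def termEval (D : ℕ → R → R) {α : Type*} (v : α → R) : shfLang.Term α → R
  | .var a => v a
  | .func f ts => shfOp D f fun i => termEval D v (ts i)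

/-- Every function symbol of `shfLang` is one of the known ones. -/
theorem shfLang_cases {P : ∀ n, shfLang.Functions n → Prop}
    (add : P 2 (Sum.inl ringFunc.add)) (mul : P 2 (Sum.inl ringFunc.mul))
    (neg : P 1 (Sum.inl ringFunc.neg)) (zero : P 0 (Sum.inl ringFunc.zero))
    (one : P 0 (Sum.inl ringFunc.one)) (der : ∀ n, P 1 (dSymb n)) :
    ∀ n (f : shfLang.Functions n), P n f
  | _, Sum.inl ringFunc.add => add
  | _, Sum.inl ringFunc.mul => mul
  | _, Sum.inl ringFunc.neg => neg
  | _, Sum.inl ringFunc.zero => zero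
  | _, Sum.inl ringFunc.one => one
  | 0, Sum.inr f => Empty.elim f
  | 1, Sum.inr (n : ℕ) => der n
  | _ + 2, Sum.inr f => Empty.elim f

/-- A ring homomorphism commuting with sufficiently many of the operators commutes with the
evaluation of a given term. -/
theorem exists_map_termEval {α : Type*} (t : shfLang.Term α) : ∃ N₀ : ℕ, ∀ N, N₀ ≤ N →
    ∀ (A B : Type) [CommRing A] [CommRing B] (D : ℕ → A → A) (D' : ℕ → B → B) (f : A →+* B),
      (∀ j < N, ∀ x, f (D j x) = D' j (f x)) → ∀ v : α → A,
        f (termEval D v t) = termEval D' (fun a => f (v a)) t := by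
  induction t with
  | var a => exact ⟨0, fun _ _ _ _ _ _ _ _ _ _ _ => rfl⟩
  | @func n f ts ih =>
    choose N₀ hN₀ using ih
    have hf : ∃ N₁ : ℕ, ∀ N, N₁ ≤ N → ∀ (A B : Type) [CommRing A] [CommRing B] (D : ℕ → A → A)
        (D' : ℕ → B → B) (g : A →+* B), (∀ j < N, ∀ x, g (D j x) = D' j (g x)) →
        ∀ x : Fin n → A, g (shfOp D f x) = shfOp D' f fun i => g (x i) := by
      clear hN₀ N₀ ts
      induction n, f using shfLang_cases with
      | add => exact ⟨0, fun _ _ _ _ _ _ _ _ g _ x => map_add g _ _⟩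
      | mul => exact ⟨0, fun _ _ _ _ _ _ _ _ g _ x => map_mul g _ _⟩
      | neg => exact ⟨0, fun _ _ _ _ _ _ _ _ g _ x => map_neg g _⟩
      | zero => exact ⟨0, fun _ _ _ _ _ _ _ _ g _ x => map_zero g⟩
      | one => exact ⟨0, fun _ _ _ _ _ _ _ _ g _ x => map_one g⟩
      | der n => exact ⟨n + 1, fun _ hN _ _ _ _ _ _ g hg x => hg n hN _⟩
    obtain ⟨N₁, hN₁⟩ := hf
    refine ⟨N₁ + ∑ i, N₀ i, fun N hN A B _ _ D D' g hg v => ?_⟩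
    simp only [termEval]
    rw [hN₁ N (by omega) A B D D' g hg]
    congr 1
    funext i
    refine hN₀ i N ?_ A B D D' g hg v
    have := Finset.single_le_sum (f := N₀) (fun _ _ => Nat.zero_le _) (Finset.mem_univ i)
    omega

end TermEval

section CoefficientwiseDerivation

variable {I K : Type*} [Field K]

/-- The coefficientwise action of operators on a polynomial ring. -/
def mvPolyD (D : ℕ → K → K) (j : ℕ) (q : MvPolynomial I K) : MvPolynomial I K :=
  ∑ m ∈ q.support, MvPolynomial.monomial m (D j (q.coeff m))

theorem eval₂_mvPolyD {F : Type*} [Field F] {D : ℕ → K → K} {D' : ℕ → F → F}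
    (h' : IsHasse D') (g : K →+* F) {N : ℕ} (hg : ∀ j < N, ∀ x, g (D j x) = D' j (g x))
    {c : I → F} (hc : ∀ i, c i ∈ h'.constants N) {j : ℕ} (hj : j < N) (q : MvPolynomial I K) :
    MvPolynomial.eval₂Hom g c (mvPolyD D j q) = D' j (MvPolynomial.eval₂Hom g c q) := by
  have hm : ∀ m : I →₀ ℕ, (m.prod fun i k => c i ^ k) ∈ h'.constants N := fun m =>
    Subfield.prod_mem _ fun i _ => Subfield.pow_mem _ (hc i) _
  conv_rhs => rw [MvPolynomial.as_sum q]
  rw [mvPolyD, map_sum, map_sum, h'.map_sum]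
  refine Finset.sum_congr rfl fun m _ => ?_
  simp only [MvPolynomial.coe_eval₂Hom, MvPolynomial.eval₂_monomial]
  rw [mul_comm (g (q.coeff m)), h'.map_constants_mul hj (hm m), hg j hj, mul_comm]

/-- The polynomial obtained by applying a function to the nonzero coefficients. -/
def mvPolyMap (r : K → K) (q : MvPolynomial I K) : MvPolynomial I K :=
  ∑ m ∈ q.support, MvPolynomial.monomial m (r (q.coeff m))

theorem eval₂_eq_sum_mvPolyMap {F : Type*} [Field F] {p n : ℕ} [Fact p.Prime] [CharP K p]
    (g : K →+* F) (c : I → F) {B : Type*} [Fintype B] (b : B → K) (r : K → B → K)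
    (hr : ∀ z, z = ∑ i, r z i ^ p ^ n * b i) (q : MvPolynomial I K) :
    MvPolynomial.eval₂Hom g c q =
      ∑ i, MvPolynomial.eval₂ (g.comp (iterateFrobenius K p n)) c (mvPolyMap (r · i) q) *
        g (b i) := by
  conv_lhs => rw [MvPolynomial.as_sum q]
  simp only [mvPolyMap, map_sum, MvPolynomial.eval₂_sum, MvPolynomial.coe_eval₂Hom,
    MvPolynomial.eval₂_monomial, Finset.sum_mul]
  rw [Finset.sum_comm]
  refine Finset.sum_congr rfl fun m _ => ?_
  conv_lhs => rw [hr (q.coeff m)]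
  rw [map_sum, Finset.sum_mul]
  refine Finset.sum_congr rfl fun i _ => ?_
  simp only [map_mul, RingHom.comp_apply, iterateFrobenius_def]
  ring

theorem eval₂_eq_zero_iff_mvPolyMap {F : Type*} [Field F] {p n : ℕ} [Fact p.Prime] [CharP K p]
    [CharP F p] {D' : ℕ → F → F} (h' : IsHasse D') (g : K →+* F) (c : I → F)
    (hc : ∀ i, c i ∈ h'.constants (p ^ n)) {B : Type*} [Fintype B] (b : B → K)
    (hb : ∀ c : B → F, (∀ i, c i ∈ h'.constants (p ^ n)) → ∑ i, c i * g (b i) = 0 → c = 0)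
    (r : K → B → K) (hr : ∀ z, z = ∑ i, r z i ^ p ^ n * b i) (q : MvPolynomial I K) :
    MvPolynomial.eval₂Hom g c q = 0 ↔
      ∀ i, MvPolynomial.eval₂ (g.comp (iterateFrobenius K p n)) c (mvPolyMap (r · i) q) = 0 := by
  rw [eval₂_eq_sum_mvPolyMap g c b r hr]
  refine ⟨fun hs => congrFun (hb _ (fun i => ?_) hs), fun hs => ?_⟩
  · rw [MvPolynomial.eval₂_eq]
    refine Subfield.sum_mem _ fun m _ => Subfield.mul_mem _ ?_ ?_
    · rw [RingHom.comp_apply, iterateFrobenius_def, map_pow]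
      exact h'.pow_mem_constants n _
    · exact Subfield.prod_mem _ fun i _ => Subfield.pow_mem _ (hc i) _
  · simp [hs]

end CoefficientwiseDerivation

/-- Finitely many equations and inequations between terms which are solvable in an extension of a
separably closed field with Hasse derivatives are solvable in the field itself. -/
theorem exists_realization_of_extension {p : ℕ} [Fact p.Prime] {K F : Type} [Field K] [Field F]
    [CharP K p] [CharP F p] [IsSepClosed K] {D : ℕ → K → K} {D' : ℕ → F → F} (h : IsHasse D)
    (h' : IsHasse D') (g : K →+* F) (hg : ∀ j x, g (D j x) = D' j (g x))
    (h1 : ∀ x, D 1 x = 0 → ∃ y, x = y ^ p)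
    (hbasis : ∀ n : ℕ, ∃ (B : Type) (_ : Fintype B) (b : B → K),
      (∀ c : B → K, (∀ i, c i ∈ h.constants (p ^ n)) → ∑ i, c i * b i = 0 → c = 0) ∧
      (∀ z : K, ∃ c : B → K, (∀ i, c i ∈ h.constants (p ^ n)) ∧ z = ∑ i, c i * b i) ∧
      ∀ z : F, ∃ c : B → F, (∀ i, c i ∈ h'.constants (p ^ n)) ∧ z = ∑ i, c i * g (b i))
    {α : Type*} (w : α → K) (y : F) (T : Finset (shfLang.Term (Option α) × shfLang.Term (Option α))) :
    ∃ z : K, ∀ q ∈ T,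
      (termEval D' (fun o => o.elim y (g ∘ w)) q.1 = termEval D' (fun o => o.elim y (g ∘ w)) q.2 ↔
        termEval D (fun o => o.elim z w) q.1 = termEval D (fun o => o.elim z w) q.2) := by
  classical
  have hp := Fact.out (p := p.Prime)
  choose N₀ hN₀ using fun t : shfLang.Term (Option α) => exists_map_termEval t
  obtain ⟨k, hk⟩ : ∃ k, ∀ q ∈ T, N₀ q.1 ≤ p ^ (k + 1) ∧ N₀ q.2 ≤ p ^ (k + 1) := by
    refine ⟨∑ q ∈ T, (N₀ q.1 + N₀ q.2), fun q hq => ?_⟩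
    have h2 := Finset.single_le_sum (f := fun q => N₀ q.1 + N₀ q.2)
      (fun _ _ => Nat.zero_le _) hq
    have h3 := Nat.lt_pow_self hp.one_lt (n := ∑ q ∈ T, (N₀ q.1 + N₀ q.2) + 1)
    omega
  set n := k + 1 with hn
  obtain ⟨B, _, b, hb, hspan, hspan'⟩ := hbasis n
  have hb' : ∀ c : B → F, (∀ i, c i ∈ h'.constants (p ^ n)) → ∑ i, c i * g (b i) = 0 → c = 0 :=
    fun c hc hs => h.independent_over_constants h' g (fun j _ x => hg j x) b hb c hc hs
  obtain ⟨c, hc, hy⟩ := hspan' y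
  choose d hd hr using hspan
  choose r hdr using fun z i => h.exists_eq_pow_of_mem_constants h1 n (d z i) (hd z i)
  simp only [hdr] at hr
  let f : K →+* h'.constants (p ^ n) := (g.comp (iterateFrobenius K p n)).codRestrict _ fun x => by
    rw [RingHom.comp_apply, iterateFrobenius_def, map_pow]
    exact h'.pow_mem_constants n _
  let v : Option α → MvPolynomial B K := fun o =>
    o.elim (∑ i, MvPolynomial.X i * MvPolynomial.C (b i)) (MvPolynomial.C ∘ w)
  let Q : shfLang.Term (Option α) × shfLang.Term (Option α) → MvPolynomial B K := fun q =>
    termEval (mvPolyD D) v q.1 - termEval (mvPolyD D) v q.2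
  have hf : ∀ s : Finset (h'.constants (p ^ n)),
      (∀ l : h'.constants (p ^ n) → K, ∑ x ∈ s, f (l x) * x = 0 → ∀ x ∈ s, l x = 0) →
      ∀ l : h'.constants (p ^ n) → K, ∑ x ∈ s, f (l x) * x ^ p = 0 → ∀ x ∈ s, l x = 0 := by
    intro s hs l hl
    have h2 : (∑ x ∈ s, g (l x ^ p ^ k) * (x : F)) ^ p = 0 := by
      rw [sum_pow_char, ← ZeroMemClass.coe_zero (h'.constants (p ^ n)), ← hl]
      push_cast
      refine Finset.sum_congr rfl fun x _ => ?_
      have : (f (l x) : F) = g (l x ^ p ^ n) := rfl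
      rw [this, mul_pow, ← map_pow, ← pow_mul, ← pow_succ]
    have h3 := h.independent_of_constants h' g (N := p ^ n) (fun j _ x => hg j x)
      (fun x : s => ((x : h'.constants (p ^ n)) : F)) (fun x => x.1.2) ?_
      (fun x : s => l x ^ p ^ k) ?_
    · intro x hx
      exact eq_zero_of_pow_eq_zero (congrFun h3 ⟨x, hx⟩)
    · intro a ha hsum
      choose a' ha' using fun x => h.exists_eq_pow_of_mem_constants h1 n (a x) (ha x)
      have := hs (fun x => if hx : x ∈ s then a' ⟨x, hx⟩ else 0) ?_
      · funext x
        have h4 := this x x.2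
        rw [dif_pos x.2] at h4
        rw [ha' x, h4]
        exact zero_pow (pow_pos hp.pos _).ne'
      · apply Subtype.ext
        rw [ZeroMemClass.coe_zero, ← hsum, ← Finset.sum_coe_sort]
        push_cast
        refine Finset.sum_congr rfl fun x _ => ?_
        rw [dif_pos x.2, ha' x]
        rfl
    · rw [← eq_zero_of_pow_eq_zero h2]
      exact Finset.sum_coe_sort s fun x => g (l x ^ p ^ k) * (x : F)
  obtain ⟨c', hc'⟩ := exists_specialization p hp f hf (fun i => ⟨c i, hc i⟩)
    (T.biUnion fun q => Finset.univ.image fun i => mvPolyMap (r · i) (Q q))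
  have hcK : ∀ i, c' i ^ p ^ n ∈ h.constants (p ^ n) := fun i => h.pow_mem_constants n _
  refine ⟨∑ i, c' i ^ p ^ n * b i, fun q hq => ?_⟩
  have key : ∀ {E : Type} [Field E] [CharP E p] {D' : ℕ → E → E} (h' : IsHasse D') (g : K →+* E)
      (_ : ∀ j x, g (D j x) = D' j (g x)) (c : B → E) (_ : ∀ i, c i ∈ h'.constants (p ^ n))
      (_ : ∀ c : B → E, (∀ i, c i ∈ h'.constants (p ^ n)) → ∑ i, c i * g (b i) = 0 → c = 0),
      termEval D' (fun o => o.elim (∑ i, c i * g (b i)) (g ∘ w)) q.1 =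
        termEval D' (fun o => o.elim (∑ i, c i * g (b i)) (g ∘ w)) q.2 ↔
      ∀ i, MvPolynomial.eval₂ (g.comp (iterateFrobenius K p n)) c
        (mvPolyMap (r · i) (Q q)) = 0 := by
    intro E _ _ D' h' g hg c hc hb'
    rw [← eval₂_eq_zero_iff_mvPolyMap h' g c hc b hb' r hr, map_sub, sub_eq_zero]
    have hv : (fun o => MvPolynomial.eval₂Hom g c (v o)) =
        fun o => o.elim (∑ i, c i * g (b i)) (g ∘ w) := by
      funext o
      cases o <;> simp [v]
    rw [hN₀ q.1 _ (hk q hq).1 _ _ (mvPolyD D) D' (MvPolynomial.eval₂Hom g c)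
        (fun j hj x => eval₂_mvPolyD h' g (fun j _ => hg j) hc hj x),
      hN₀ q.2 _ (hk q hq).2 _ _ (mvPolyD D) D' (MvPolynomial.eval₂Hom g c)
        (fun j hj x => eval₂_mvPolyD h' g (fun j _ => hg j) hc hj x), hv]
  have keyK := key h (RingHom.id K) (fun _ _ => rfl) (fun i => c' i ^ p ^ n) hcK hb
  rw [hy, key h' g hg c hc hb']
  refine Iff.trans (forall_congr' fun i => ?_) keyK.symm
  have h2 := hc' (mvPolyMap (r · i) (Q q)) (Finset.mem_biUnion.2
    ⟨q, hq, Finset.mem_image_of_mem _ (Finset.mem_univ i)⟩)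
  have h3 : MvPolynomial.eval₂ (g.comp (iterateFrobenius K p n)) c (mvPolyMap (r · i) (Q q)) =
      MvPolynomial.eval₂ f (fun i => ⟨c i, hc i⟩) (mvPolyMap (r · i) (Q q)) := by
    exact (MvPolynomial.eval₂_comp_left (h'.constants (p ^ n)).subtype f
      (fun i => ⟨c i, hc i⟩) (mvPolyMap (r · i) (Q q))).symm
  have h4 : MvPolynomial.eval₂ ((RingHom.id K).comp (iterateFrobenius K p n))
      (fun i => c' i ^ p ^ n) (mvPolyMap (r · i) (Q q)) =
      MvPolynomial.eval c' (mvPolyMap (r · i) (Q q)) ^ p ^ n := by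
    rw [← iterateFrobenius_def, MvPolynomial.eval, MvPolynomial.coe_eval₂Hom,
      MvPolynomial.eval₂_comp_left]
    rfl
  rw [h3, h4, ZeroMemClass.coe_eq_zero, h2, pow_eq_zero_iff (pow_pos hp.pos _).ne']

section Transfer

theorem realize_eq_termEval {M : Type*} [shfLang.Structure M] [CommRing M]
    (hadd : ∀ a b : M, shfFun (Sum.inl ringFunc.add) ![a, b] = a + b)
    (hmul : ∀ a b : M, shfFun (Sum.inl ringFunc.mul) ![a, b] = a * b)
    (hneg : ∀ a : M, shfFun (Sum.inl ringFunc.neg) ![a] = -a)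
    (hzero : shfFun (Sum.inl ringFunc.zero) ![] = (0 : M))
    (hone : shfFun (Sum.inl ringFunc.one) ![] = (1 : M))
    {α : Type*} (v : α → M) (t : shfLang.Term α) : t.realize v = termEval shfD v t := by
  have hf : ∀ (n : ℕ) (f : shfLang.Functions n) (x : Fin n → M),
      Structure.funMap f x = shfOp shfD f x := by
    intro n f
    induction n, f using shfLang_cases with
    | add =>
      intro x
      refine Eq.trans ?_ (hadd (x 0) (x 1))
      exact congrArg _ (funext fun i => by fin_cases i <;> rfl)
    | mul =>
      intro x
      refine Eq.trans ?_ (hmul (x 0) (x 1))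
      exact congrArg _ (funext fun i => by fin_cases i <;> rfl)
    | neg =>
      intro x
      refine Eq.trans ?_ (hneg (x 0))
      exact congrArg _ (funext fun i => by fin_cases i; rfl)
    | zero => exact fun x => (congrArg _ (Subsingleton.elim _ _)).trans hzero
    | one => exact fun x => (congrArg _ (Subsingleton.elim _ _)).trans hone
    | der n => exact fun x => congrArg _ (funext fun i => by fin_cases i; rfl)
  induction t with
  | var a => rfl
  | func f ts ih =>
    simp only [Term.realize, termEval, ih]
    exact hf _ f _

theorem map_hsComp {K K' : Type*} {D : ℕ → K → K} {D' : ℕ → K' → K'} (f : K → K')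
    (hf : ∀ n x, f (D n x) = D' n (f x)) (p e : ℕ) (v : Fin e → ℕ) (x : K) :
    f (hsComp p e D v x) = hsComp p e D' v (f x) := by
  suffices H : ∀ l : List (ℕ × ℕ), f ((l.map fun q => (D q.1)^[q.2]).foldr (· ∘ ·) id x) =
      (l.map fun q => (D' q.1)^[q.2]).foldr (· ∘ ·) id (f x) by
    have := H (List.ofFn fun m : Fin e => (v m, p ^ (m : ℕ)))
    simp only [List.map_ofFn] at this
    exact this
  intro l
  induction l with
  | nil => rfl
  | cons q l ih =>
    simp only [List.map_cons, List.foldr_cons, Function.comp_apply]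
    rw [← ih]
    exact Function.Semiconj.iterate_right (hf q.1) q.2 _

variable {R R' : Type*} [CommRing R] [CommRing R'] {α : Type*}

/-- The subring of values of terms. -/
def termSubring (D : ℕ → R → R) (v : α → R) : Subring R where
  carrier := Set.range (termEval D v)
  add_mem' := by
    rintro _ _ ⟨t, rfl⟩ ⟨s, rfl⟩
    exact ⟨.func (Sum.inl ringFunc.add : shfLang.Functions 2) ![t, s], rfl⟩
  mul_mem' := by
    rintro _ _ ⟨t, rfl⟩ ⟨s, rfl⟩
    exact ⟨.func (Sum.inl ringFunc.mul : shfLang.Functions 2) ![t, s], rfl⟩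
  neg_mem' := by
    rintro _ ⟨t, rfl⟩
    exact ⟨.func (Sum.inl ringFunc.neg : shfLang.Functions 1) ![t], rfl⟩
  zero_mem' := ⟨.func (Sum.inl ringFunc.zero : shfLang.Functions 0) ![], rfl⟩
  one_mem' := ⟨.func (Sum.inl ringFunc.one : shfLang.Functions 0) ![], rfl⟩

/-- Tuples satisfying the same equations generate isomorphic structures. -/
theorem exists_hom_termSubring {D : ℕ → R → R} {D' : ℕ → R' → R'} {v : α → R} {w : α → R'}
    (hvw : ∀ t s, termEval D v t = termEval D v s → termEval D' w t = termEval D' w s) :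
    ∃ σ : termSubring D v →+* R', ∀ t, σ ⟨termEval D v t, t, rfl⟩ = termEval D' w t := by
  choose τ hτ using fun x : termSubring D v => x.2
  have hσ : ∀ (x : termSubring D v) t, termEval D v t = x → termEval D' w (τ x) = termEval D' w t :=
    fun x t ht => hvw _ _ ((hτ x).trans ht.symm)
  refine ⟨⟨⟨⟨fun x => termEval D' w (τ x), ?_⟩, fun x y => ?_⟩, ?_, fun x y => ?_⟩,
    fun t => hσ _ t rfl⟩
  · exact hσ 1 (.func (Sum.inl ringFunc.one : shfLang.Functions 0) ![]) rfl
  · refine hσ _ (.func (Sum.inl ringFunc.mul : shfLang.Functions 2) ![τ x, τ y]) ?_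
    exact congrArg₂ (· * ·) (hτ x) (hτ y)
  · exact hσ 0 (.func (Sum.inl ringFunc.zero : shfLang.Functions 0) ![]) rfl
  · refine hσ _ (.func (Sum.inl ringFunc.add : shfLang.Functions 2) ![τ x, τ y]) ?_
    exact congrArg₂ (· + ·) (hτ x) (hτ y)

/-- If two tuples in models satisfy the same equations between terms, then finitely many equations
and inequations solvable over the one are solvable over the other. -/
theorem IsSHFStructure.exists_realization {p e : ℕ} [Fact p.Prime] (he : 0 < e) {M N : Type}
    [shfLang.Structure M] [shfLang.Structure N] (hM : IsSHFStructure p e M)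
    (hN : IsSHFStructure p e N) {α : Type*} {v : α → M} {w : α → N}
    (hvw : ∀ t s : shfLang.Term α, t.realize v = s.realize v ↔ t.realize w = s.realize w) (y : M)
    (T : Finset (shfLang.Term (Option α) × shfLang.Term (Option α))) :
    ∃ z : N, ∀ q ∈ T,
      (q.1.realize (fun o : Option α => o.elim y v) = q.2.realize (fun o : Option α => o.elim y v) ↔
        q.1.realize (fun o : Option α => o.elim z w) =
          q.2.realize (fun o : Option α => o.elim z w)) := by
  obtain ⟨_, _, addM, mulM, negM, zeroM, oneM, -, idM, linM, leibM, commM, -, -, -, wittM⟩ := hM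
  obtain ⟨_, _, addN, mulN, negN, zeroN, oneN, _, idN, linN, leibN, commN, nilN, rankN, strictN,
    wittN⟩ := hN
  simp only [realize_eq_termEval addM mulM negM zeroM oneM,
    realize_eq_termEval addN mulN negN zeroN oneN] at hvw ⊢
  have hM : IsHasse (shfD (M := M)) := ⟨idM, linM, leibM⟩
  have hN : IsHasse (shfD (M := N)) := ⟨idN, linN, leibN⟩
  obtain ⟨φ, hφ, hφc, hφD⟩ := exists_wittExpansion he hM commM wittM
  obtain ⟨φ', hφ', hφc', hφD'⟩ := exists_wittExpansion he hN commN wittN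
  obtain ⟨σ, hσ⟩ := exists_hom_termSubring fun t s => (hvw t s).1
  have hσi : Function.Injective σ := by
    rintro ⟨_, t, rfl⟩ ⟨_, s, rfl⟩ hxy
    rw [hσ, hσ] at hxy
    exact Subtype.ext ((hvw t s).2 hxy)
  have hS : ∀ (s : termSubring (shfD (M := M)) v) (n : Fin e →₀ ℕ), ∃ t : termSubring shfD v,
      MvPowerSeries.coeff n (φ ((termSubring shfD v).subtype s)) = (termSubring shfD v).subtype t ∧
      MvPowerSeries.coeff n (φ' (σ s)) = σ t := by
    rintro ⟨_, t, rfl⟩ n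
    let dT : ℕ → shfLang.Term α → shfLang.Term α := fun n t => .func (dSymb n) ![t]
    refine ⟨⟨termEval shfD v (hsComp p e dT n t), _, rfl⟩, ?_, ?_⟩
    · rw [hφc]
      exact (map_hsComp (termEval shfD v) (fun _ _ => rfl) p e n t).symm
    · rw [hφc', hσ, hσ]
      exact (map_hsComp (termEval shfD w) (fun _ _ => rfl) p e n t).symm
  obtain ⟨F, _, ι, ι', Φ, hιι', hι, hι', hΦ⟩ := exists_wittExpansion_amalgam
    (termSubring shfD v).subtype σ (Subring.subtype_injective _) hσi hφ hφ' hS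
  have : CharP F p := charP_of_injective_ringHom ι.injective p
  have hDN : (fun n x => MvPowerSeries.coeff (Finsupp.single (⟨0, he⟩ : Fin e) n) (φ' x)) =
      shfD := funext fun n => funext fun x => hφD' n x
  have hstrict : ∀ x, MvPowerSeries.coeff (Finsupp.single (⟨0, he⟩ : Fin e) 1) (φ' x) = 0 →
      ∃ y, x = y ^ p := by simpa only [hφD'] using strictN
  have hp := (Fact.out (p := p.Prime)).pos
  have hd : p ^ e - 1 + 1 = p ^ e := Nat.sub_add_cancel (pow_pos hp e)
  have hιv : ι ∘ v = ι' ∘ w := funext fun a =>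
    (hιι' ⟨v a, .var a, rfl⟩).trans (congrArg ι' (hσ (.var a)))
  obtain ⟨x, hx⟩ := rankN
  obtain ⟨z, hz⟩ := exists_realization_of_extension (isHasse_coeff_single hφ'.constantCoeff ⟨0, he⟩)
    (isHasse_coeff_single hΦ.constantCoeff ⟨0, he⟩) ι'
    (fun j x => by rw [hι', MvPowerSeries.coeff_map]) hstrict
    (fun n => by
      obtain ⟨B, _, b, hcard, hb⟩ := (isHasse_coeff_single hφ'.constantCoeff
        ⟨0, he⟩).exists_independent hstrict (d := p ^ e - 1) (x := x) (by simpa only [hφD'] using hx)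
        (by simpa only [hφD', hd] using nilN 1 le_rfl) n
      rw [hd, ← pow_mul, mul_comm, pow_mul] at hcard
      refine ⟨B, inferInstance, b, hb, hφ'.exists_constants_combination _ n hcard b hb,
        hΦ.exists_constants_combination _ n hcard _ fun c hc hs => ?_⟩
      exact (isHasse_coeff_single hφ'.constantCoeff ⟨0, he⟩).independent_over_constants
        (isHasse_coeff_single hΦ.constantCoeff ⟨0, he⟩) ι'
        (fun j _ x => by rw [hι', MvPowerSeries.coeff_map]) b hb c hc hs) w (ι y) T
  refine ⟨z, fun q hq => ?_⟩
  have hq := hz q hq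
  rw [hDN] at hq
  rw [← hq]
  have key : ∀ t : shfLang.Term (Option α), ι (termEval shfD (fun o => o.elim y v) t) =
      termEval (fun n x => MvPowerSeries.coeff (Finsupp.single (⟨0, he⟩ : Fin e) n) (Φ x))
        (fun o => o.elim (ι y) (ι' ∘ w)) t := by
    intro t
    obtain ⟨N₀, hN₀⟩ := exists_map_termEval t
    rw [hN₀ N₀ le_rfl M F shfD
      (fun n x => MvPowerSeries.coeff (Finsupp.single (⟨0, he⟩ : Fin e) n) (Φ x)) ι fun j _ x => ?_]
    · rw [← hιv]
      congr 1
      funext o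
      cases o <;> rfl
    · rw [hι, MvPowerSeries.coeff_map, hφD]
  rw [← key, ← key, ι.injective.eq_iff]

end Transfer

section Ultraproduct

open Filter

variable {α : Type*} (u : Ultrafilter α) (M : α → Type*)

/-- Equality along an ultrafilter as a ring congruence. -/
def ultraproductCon [∀ i, CommRing (M i)] : RingCon (∀ i, M i) where
  toSetoid := (u : Filter α).productSetoid M
  add' h h' := by
    filter_upwards [h, h'] with i hi hi'
    exact congrArg₂ (· + ·) hi hi'
  mul' h h' := by
    filter_upwards [h, h'] with i hi hi'
    exact congrArg₂ (· * ·) hi hi'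

theorem isField_ultraproductCon [∀ i, Field (M i)] : IsField (ultraproductCon u M).Quotient where
  exists_pair_ne := by
    refine ⟨(ultraproductCon u M).mk' 0, (ultraproductCon u M).mk' 1, fun h => ?_⟩
    obtain ⟨i, hi⟩ := (Quotient.exact h : ∀ᶠ i in u, (0 : M i) = 1).exists
    exact zero_ne_one hi
  mul_comm := mul_comm
  mul_inv_cancel := by
    rintro ⟨x⟩ hx
    refine ⟨(ultraproductCon u M).mk' fun i => (x i)⁻¹, Quotient.sound ?_⟩
    have h : ∀ᶠ i in u, ¬ x i = 0 := Ultrafilter.eventually_not.2 fun h => hx (Quotient.sound h)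
    exact h.mono fun i hi => mul_inv_cancel₀ hi

/-- An ultraproduct of separably closed fields is a separably closed field. -/
theorem exists_field_ultraproduct [∀ i, Field (M i)] [∀ i, IsSepClosed (M i)] :
    ∃ (_ : Field ((u : Filter α).Product M)) (π : (∀ i, M i) →+* (u : Filter α).Product M),
      (∀ x, π x = (x : (u : Filter α).Product M)) ∧ IsSepClosed ((u : Filter α).Product M) := by
  let _ : Field ((u : Filter α).Product M) := (isField_ultraproductCon u M).toField
  let π : (∀ i, M i) →+* (u : Filter α).Product M := (ultraproductCon u M).mk'
  have hπ : Function.Surjective π := Quotient.mk''_surjective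
  have hπ0 : ∀ x, π x = 0 → ∀ᶠ i in u, x i = 0 := fun x hx => Quotient.exact hx
  refine ⟨inferInstance, π, fun _ => rfl, IsSepClosed.of_exists_root _ fun f hf hirr hsep => ?_⟩
  obtain ⟨a, b, hab⟩ := hsep
  obtain ⟨a, rfl⟩ := Polynomial.map_surjective π hπ a
  obtain ⟨b, rfl⟩ := Polynomial.map_surjective π hπ b
  obtain ⟨f, rfl, hdeg, hmonic⟩ := Polynomial.lifts_and_natDegree_eq_and_monic
    (Polynomial.map_surjective π hπ f) hf
  have hev : ∀ᶠ i in u, (f.map (Pi.evalRingHom M i)).Separable := by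
    have hzero : (a * f + b * Polynomial.derivative f - 1).map π = 0 := by
      rw [Polynomial.map_sub, Polynomial.map_add, Polynomial.map_mul, Polynomial.map_mul,
        ← Polynomial.derivative_map, hab, Polynomial.map_one, sub_self]
    set g := a * f + b * Polynomial.derivative f - 1 with hg
    have hcoeff : ∀ᶠ i in u, ∀ k ∈ g.support, g.coeff k i = 0 := by
      rw [Filter.eventually_all_finset]
      intro k _
      refine hπ0 _ ?_
      rw [← Polynomial.coeff_map, hzero, Polynomial.coeff_zero]
    filter_upwards [hcoeff] with i hi
    have hgi : g.map (Pi.evalRingHom M i) = 0 := by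
      ext k
      rw [Polynomial.coeff_map, Polynomial.coeff_zero]
      by_cases hk : k ∈ g.support
      · exact hi k hk
      · rw [Polynomial.notMem_support_iff.1 hk, map_zero]
    refine ⟨a.map (Pi.evalRingHom M i), b.map (Pi.evalRingHom M i), ?_⟩
    rw [Polynomial.derivative_map, ← Polynomial.map_mul, ← Polynomial.map_mul,
      ← Polynomial.map_add, ← sub_eq_zero, ← hgi, hg, Polynomial.map_sub, Polynomial.map_one]
  have hroot : ∀ i, ∃ x : M i, (f.map (Pi.evalRingHom M i)).Separable →
      (f.map (Pi.evalRingHom M i)).eval x = 0 := by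
    intro i
    by_cases hs : (f.map (Pi.evalRingHom M i)).Separable
    · obtain ⟨x, hx⟩ := IsSepClosed.exists_root (f.map (Pi.evalRingHom M i)) (by
        intro h0
        have h1 := Polynomial.natDegree_eq_of_degree_eq_some h0
        rw [hmonic.natDegree_map, hdeg] at h1
        exact hirr.natDegree_pos.ne' h1) hs
      exact ⟨x, fun _ => hx⟩
    · exact ⟨0, fun h => absurd h hs⟩
  choose x hx using hroot
  refine ⟨π x, ?_⟩
  rw [Polynomial.eval_map_apply]
  refine Quotient.sound (hev.mono fun i hi => ?_)
  exact (Polynomial.eval_map_apply (Pi.evalRingHom M i) x).symm.trans (hx i hi)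

end Ultraproduct

section Closure

open Filter

theorem finsum_wittAlpha_fun {p e : ℕ} [Fact p.Prime] {F : Type*} [Field F] [CharP F p] (n : ℕ)
    {i j : Fin e → ℕ} (hi : ∀ m, i m < p ^ n) (hj : ∀ m, j m < p ^ n) (f : (Fin e → ℕ) → F) :
    ∑ᶠ l : Fin e → ℕ, ZMod.cast (wittAlpha p e i j l) * f l =
      ∑ ω : Fin e → Fin (p ^ n), ZMod.cast (wittAlpha p e i j fun m => ω m) * f fun m => ω m :=
  (finsum_comp_equiv (Finsupp.equivFunOnFinite : (Fin e →₀ ℕ) ≃ (Fin e → ℕ))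
    (f := fun l => (ZMod.cast (wittAlpha p e i j l) * f l : F))).symm.trans
    (finsum_wittAlpha n hi hj fun l => f l)

/-- The class of models is closed under ultraproducts. -/
theorem IsSHFStructure.ultraproduct {p e : ℕ} [Fact p.Prime] {α : Type} (u : Ultrafilter α)
    (M : α → Type) [∀ i, shfLang.Structure (M i)] (hM : ∀ i, IsSHFStructure p e (M i)) :
    IsSHFStructure p e ((u : Filter α).Product M) := by
  choose _ _ hadd hmul hneg hzero hone _ hid hlin hleib hcomm hnil hrank hstrict hwitt using hM
  obtain ⟨_, π, hπ, hsep⟩ := exists_field_ultraproduct u M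
  have hsurj : ∀ y, ∃ x, π x = y := by
    rintro ⟨x⟩
    exact ⟨x, hπ x⟩
  have heq : ∀ x y, π x = π y ↔ ∀ᶠ i in u, x i = y i := fun x y => by
    rw [hπ, hπ]
    exact Quotient.eq''
  have hfun : ∀ {n : ℕ} (f : shfLang.Functions n) (x : Fin n → ∀ i, M i),
      shfFun f (fun k => π (x k)) = π fun i => shfFun f fun k => x k i := by
    intro n f x
    simp only [hπ]
    exact Ultraproduct.funMap_cast f x
  have hfun₂ : ∀ (f : shfLang.Functions 2) a b,
      shfFun f ![π a, π b] = π fun i => shfFun f ![a i, b i] := by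
    intro f a b
    refine Eq.trans (congrArg _ ?_) ((hfun f ![a, b]).trans (congrArg π (funext fun i =>
      congrArg _ ?_)))
    all_goals exact funext fun k => by fin_cases k <;> rfl
  have hfun₁ : ∀ (f : shfLang.Functions 1) a, shfFun f ![π a] = π fun i => shfFun f ![a i] := by
    intro f a
    refine Eq.trans (congrArg _ ?_) ((hfun f ![a]).trans (congrArg π (funext fun i =>
      congrArg _ ?_)))
    all_goals exact funext fun k => by fin_cases k; rfl
  have hfun₀ : ∀ f : shfLang.Functions 0,
      shfFun f ![] = π fun i => shfFun f (![] : Fin 0 → M i) := by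
    intro f
    exact Eq.trans (congrArg _ (Subsingleton.elim _ _)) ((hfun f ![]).trans
      (congrArg π (funext fun i => congrArg _ (Subsingleton.elim _ _))))
  have hD : ∀ n x, shfD n (π x) = π fun i => shfD n (x i) := fun n x => hfun₁ (dSymb n) x
  have hiter : ∀ n k x, (shfD n)^[k] (π x) = π fun i => (shfD n)^[k] (x i) := by
    intro n k
    induction k with
    | zero => exact fun _ => rfl
    | succ k ih =>
      intro x
      rw [Function.iterate_succ_apply, hD, ih]
      rfl
  let Dπ : ℕ → (∀ i, M i) → ∀ i, M i := fun n x i => shfD n (x i)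
  have hcomp : ∀ v x, hsComp p e shfD v (π x) = π fun i => hsComp p e shfD v (x i) := by
    intro v x
    rw [← map_hsComp (D := Dπ) π (fun n x => (hD n x).symm)]
    congr 1
    funext i
    exact map_hsComp (D := Dπ) (fun x : ∀ i, M i => x i) (fun _ _ => rfl) p e v x
  have hchar : CharP ((u : Filter α).Product M) p := by
    rw [CharP.charP_iff_prime_eq_zero (Fact.out (p := p.Prime)), ← map_natCast π, ← map_zero π]
    congr 1
    funext i
    exact CharP.cast_eq_zero (M i) p
  have hcast : ∀ a : ZMod p, (ZMod.cast a : (u : Filter α).Product M) =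
      π fun i => (ZMod.cast a : M i) := fun a =>
    RingHom.congr_fun (Subsingleton.elim (ZMod.castHom dvd_rfl _)
      (π.comp (RingHom.pi fun i => ZMod.castHom dvd_rfl (M i)))) a
  refine ⟨inferInstance, hchar, ?_, ?_, ?_, ?_, ?_, hsep, ?_, ?_, ?_, ?_, ?_, ?_, ?_, ?_⟩
  · intro a b
    obtain ⟨a, rfl⟩ := hsurj a
    obtain ⟨b, rfl⟩ := hsurj b
    exact (hfun₂ _ a b).trans ((congrArg π (funext fun i => hadd i (a i) (b i))).trans
      (map_add π a b))
  · intro a b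
    obtain ⟨a, rfl⟩ := hsurj a
    obtain ⟨b, rfl⟩ := hsurj b
    exact (hfun₂ _ a b).trans ((congrArg π (funext fun i => hmul i (a i) (b i))).trans
      (map_mul π a b))
  · intro a
    obtain ⟨a, rfl⟩ := hsurj a
    exact (hfun₁ _ a).trans ((congrArg π (funext fun i => hneg i (a i))).trans (map_neg π a))
  · exact (hfun₀ _).trans ((congrArg π (funext hzero)).trans (map_zero π))
  · exact (hfun₀ _).trans ((congrArg π (funext hone)).trans (map_one π))
  · intro x
    obtain ⟨x, rfl⟩ := hsurj x
    rw [hD]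
    simp only [hid]
  · intro n x y
    obtain ⟨x, rfl⟩ := hsurj x
    obtain ⟨y, rfl⟩ := hsurj y
    rw [← map_add, hD, hD, hD, ← map_add]
    exact congrArg π (funext fun i => hlin i n (x i) (y i))
  · intro n x y
    obtain ⟨x, rfl⟩ := hsurj x
    obtain ⟨y, rfl⟩ := hsurj y
    simp only [← map_mul, hD, ← map_sum]
    congr 1
    funext i
    rw [Finset.sum_apply]
    exact hleib i n (x i) (y i)
  · intro j k x
    obtain ⟨x, rfl⟩ := hsurj x
    simp only [hD]
    exact congrArg π (funext fun i => hcomm i j k (x i))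
  · intro n hn x
    obtain ⟨x, rfl⟩ := hsurj x
    rw [hiter, ← map_zero π]
    exact congrArg π (funext fun i => hnil i n hn (x i))
  · choose x hx using hrank
    refine ⟨π x, ?_⟩
    rw [hiter, ← map_zero π, Ne, heq]
    exact fun h => h.exists.elim hx
  · intro x hx
    obtain ⟨x, rfl⟩ := hsurj x
    rw [hD, ← map_zero π, heq] at hx
    have hy : ∀ i, ∃ y : M i, shfD 1 (x i) = 0 → x i = y ^ p := fun i => by
      by_cases h : shfD 1 (x i) = 0
      · obtain ⟨y, hy⟩ := hstrict i (x i) h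
        exact ⟨y, fun _ => hy⟩
      · exact ⟨0, fun h' => absurd h' h⟩
    choose y hy using hy
    exact ⟨π y, by rw [← map_pow, heq]; exact hx.mono fun i hi => hy i hi⟩
  · intro j k x
    obtain ⟨x, rfl⟩ := hsurj x
    obtain ⟨n, hj, hk⟩ : ∃ n, (∀ m, j m < p ^ n) ∧ ∀ m, k m < p ^ n := by
      refine ⟨∑ m, (j m + k m), ?_, ?_⟩ <;> intro m <;>
      · have h1 := Finset.single_le_sum (f := fun m => j m + k m) (fun _ _ => Nat.zero_le _)
          (Finset.mem_univ m)
        have h2 := Nat.lt_pow_self (Fact.out (p := p.Prime)).one_lt (n := ∑ m, (j m + k m))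
        omega
    rw [finsum_wittAlpha_fun n hj hk]
    simp only [hcomp, hcast, ← map_mul, ← map_sum]
    congr 1
    funext i
    rw [hwitt, finsum_wittAlpha_fun n hj hk, Finset.sum_apply]
    rfl

end Closure

section QuantifierElimination

variable {L : FirstOrder.Language} {α β : Type*}

/-- A condition that depends only on the truth values of finitely many equations is
quantifier-free definable. -/
theorem FirstOrder.Language.exists_isQF_of_finset_bdEqual {ι : Type*} {k : ℕ} (M : ι → Type*)
    [∀ i, L.Structure (M i)] (v : ∀ i, β → M i) (xs : ∀ i, Fin k → M i)
    (T : Finset (L.Term (β ⊕ Fin k) × L.Term (β ⊕ Fin k))) (S : ι → Prop)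
    (hS : ∀ i j, (∀ q ∈ T, (q.1.bdEqual q.2).Realize (v i) (xs i) ↔
      (q.1.bdEqual q.2).Realize (v j) (xs j)) → S i → S j) :
    ∃ ζ : L.BoundedFormula β k, ζ.IsQF ∧ ∀ i, ζ.Realize (v i) (xs i) ↔ S i := by
  classical
  induction T using Finset.induction_on generalizing S with
  | empty =>
    by_cases h : ∃ i, S i
    · obtain ⟨i, hi⟩ := h
      exact ⟨⊤, .top, fun j =>
        iff_of_true (BoundedFormula.realize_top.2 trivial) (hS i j (by simp) hi)⟩
    · exact ⟨⊥, BoundedFormula.isQF_bot, fun j => iff_of_false id fun hj => h ⟨j, hj⟩⟩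
  | insert δ T _ ih =>
    have key : ∀ c : Prop, ∃ ζ : L.BoundedFormula β k, ζ.IsQF ∧
        ∀ i, ((δ.1.bdEqual δ.2).Realize (v i) (xs i) ↔ c) →
          (ζ.Realize (v i) (xs i) ↔ S i) := by
      intro c
      obtain ⟨ζ, hζ, h⟩ := ih (fun i => ∃ j, ((δ.1.bdEqual δ.2).Realize (v j) (xs j) ↔ c) ∧
        (∀ q ∈ T, (q.1.bdEqual q.2).Realize (v j) (xs j) ↔
          (q.1.bdEqual q.2).Realize (v i) (xs i)) ∧ S j)
        fun i j hij ⟨l, hl, hli, hSl⟩ => ⟨l, hl, fun q hq => (hli q hq).trans (hij q hq), hSl⟩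
      refine ⟨ζ, hζ, fun i hi => (h i).trans ⟨?_, fun hSi => ⟨i, hi, fun _ _ => Iff.rfl, hSi⟩⟩⟩
      rintro ⟨j, hj, hji, hSj⟩
      refine hS j i (fun q hq => ?_) hSj
      obtain rfl | hq := Finset.mem_insert.1 hq
      · exact hj.trans hi.symm
      · exact hji q hq
    obtain ⟨ζ₁, hζ₁, h₁⟩ := key True
    obtain ⟨ζ₀, hζ₀, h₀⟩ := key False
    have hδ : (δ.1.bdEqual δ.2 : L.BoundedFormula β k).IsQF :=
      (BoundedFormula.IsAtomic.equal _ _).isQF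
    refine ⟨(δ.1.bdEqual δ.2 ⊓ ζ₁) ⊔ ((δ.1.bdEqual δ.2).not ⊓ ζ₀),
      (hδ.inf hζ₁).sup (hδ.not.inf hζ₀), fun i => ?_⟩
    rw [BoundedFormula.realize_sup, BoundedFormula.realize_inf, BoundedFormula.realize_inf,
      BoundedFormula.realize_not]
    by_cases hi : (δ.1.bdEqual δ.2).Realize (v i) (xs i)
    · simp only [hi, true_and, not_true, false_and, or_false, h₁ i (iff_true_intro hi)]
    · simp only [hi, not_false_iff, true_and, false_and, false_or, h₀ i (iff_false_intro hi)]

/-- In a language without relation symbols, the truth of a quantifier-free formula is determined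
by the truth of finitely many equations. -/
theorem FirstOrder.Language.BoundedFormula.IsQF.exists_finset_bdEqual
    [∀ n, IsEmpty (L.Relations n)] {k : ℕ} {ζ : L.BoundedFormula β k} (hζ : ζ.IsQF) :
    ∃ T : Finset (L.Term (β ⊕ Fin k) × L.Term (β ⊕ Fin k)), ∀ (M N : Type) [L.Structure M]
      [L.Structure N] (v : β → M) (xs : Fin k → M) (w : β → N) (ys : Fin k → N),
      (∀ q ∈ T, (q.1.bdEqual q.2).Realize v xs ↔ (q.1.bdEqual q.2).Realize w ys) →
        (ζ.Realize v xs ↔ ζ.Realize w ys) := by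
  classical
  induction hζ with
  | falsum => exact ⟨∅, fun _ _ _ _ _ _ _ _ _ => Iff.rfl⟩
  | of_isAtomic h =>
    cases h with
    | equal t s => exact ⟨{(t, s)}, fun _ _ _ _ _ _ _ _ h => h _ (Finset.mem_singleton_self _)⟩
    | rel r _ => exact isEmptyElim r
  | imp _ _ ih₁ ih₂ =>
    obtain ⟨T₁, h₁⟩ := ih₁
    obtain ⟨T₂, h₂⟩ := ih₂
    refine ⟨T₁ ∪ T₂, fun M N _ _ v xs w ys h => ?_⟩
    rw [BoundedFormula.realize_imp, BoundedFormula.realize_imp,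
      h₁ M N v xs w ys fun q hq => h q (Finset.mem_union_left _ hq),
      h₂ M N v xs w ys fun q hq => h q (Finset.mem_union_right _ hq)]

instance (n : ℕ) : IsEmpty (shfLang.Relations n) :=
  inferInstanceAs (IsEmpty (Empty ⊕ Empty))

/-- A model of `SHF-bar_{p,e}` together with an assignment of the variables in `α`. -/
structure SHFAssignment (p e : ℕ) [Fact p.Prime] (α : Type) where
  /-- The underlying model. -/
  carrier : Type
  [str : shfLang.Structure carrier]
  isSHFStructure : IsSHFStructure p e carrier
  /-- The assignment of the variables. -/
  val : α → carrier

attribute [instance] SHFAssignment.str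

/-- A formula `∀ x, ζ` with `ζ` quantifier-free is equivalent to a quantifier-free formula. -/
theorem FirstOrder.Language.BoundedFormula.IsQF.exists_isQF_all {p e : ℕ} [Fact p.Prime]
    (he : 0 < e) {β : Type} {k : ℕ} {ζ : shfLang.BoundedFormula β (k + 1)} (hζ : ζ.IsQF) :
    ∃ ψ : shfLang.BoundedFormula β k, ψ.IsQF ∧ ∀ (M : Type) [shfLang.Structure M],
      IsSHFStructure p e M → ∀ (v : β → M) (xs : Fin k → M),
        ζ.all.Realize v xs ↔ ψ.Realize v xs := by
  classical
  by_contra hcon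
  have hsep : ∀ T : Finset (shfLang.Term (β ⊕ Fin k) × shfLang.Term (β ⊕ Fin k)),
      ∃ A B : SHFAssignment p e (β ⊕ Fin k),
        (∀ q ∈ T, q.1.realize A.val = q.2.realize A.val ↔ q.1.realize B.val = q.2.realize B.val) ∧
        ζ.all.Realize (A.val ∘ Sum.inl) (A.val ∘ Sum.inr) ∧
        ¬ ζ.all.Realize (B.val ∘ Sum.inl) (B.val ∘ Sum.inr) := by
    intro T
    by_contra! h
    obtain ⟨ψ, hψ, hequiv⟩ := exists_isQF_of_finset_bdEqual
      (fun A : SHFAssignment p e (β ⊕ Fin k) => A.carrier) (fun A => A.val ∘ Sum.inl)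
      (fun A => A.val ∘ Sum.inr) T
      (fun A => ζ.all.Realize (A.val ∘ Sum.inl) (A.val ∘ Sum.inr))
      (fun A B hAB => h A B (by simpa only [BoundedFormula.realize_bdEqual,
        Sum.elim_comp_inl_inr] using hAB))
    exact hcon ⟨ψ, hψ, fun M _ hM v xs => (hequiv ⟨M, hM, Sum.elim v xs⟩).symm⟩
  choose A B hAB hA hB using hsep
  let u := Ultrafilter.of (Filter.atTop :
    Filter (Finset (shfLang.Term (β ⊕ Fin k) × shfLang.Term (β ⊕ Fin k))))
  have hne : ∀ C : SHFAssignment p e (β ⊕ Fin k), Nonempty C.carrier := fun C =>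
    ⟨shfFun (Sum.inl ringFunc.zero) ![]⟩
  let ν : ∀ C : Finset (shfLang.Term (β ⊕ Fin k) × shfLang.Term (β ⊕ Fin k)) →
    SHFAssignment p e (β ⊕ Fin k), β ⊕ Fin k → (u : Filter _).Product fun T => (C T).carrier :=
    fun C b => Quotient.mk _ fun T => (C T).val b
  have hterm : ∀ C (t s : shfLang.Term (β ⊕ Fin k)), t.realize (ν C) = s.realize (ν C) ↔
      ∀ᶠ T in u, t.realize (C T).val = s.realize (C T).val := by
    intro C t s
    have hcast := fun t : shfLang.Term (β ⊕ Fin k) =>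
      Ultraproduct.term_realize_cast (u := u) (fun b T => (C T).val b) t
    exact (Eq.congr (hcast t) (hcast s)).trans Quotient.eq''
  have hsame : ∀ t s : shfLang.Term (β ⊕ Fin k), t.realize (ν B) = s.realize (ν B) ↔
      t.realize (ν A) = s.realize (ν A) := by
    intro t s
    rw [hterm, hterm]
    refine Filter.eventually_congr ?_
    filter_upwards [Ultrafilter.of_le _ (Filter.eventually_ge_atTop {(t, s)})] with T hT
    exact (hAB T (t, s) (Finset.singleton_subset_iff.1 hT)).symm
  have hall : ∀ C, ζ.all.Realize (ν C ∘ Sum.inl) (ν C ∘ Sum.inr) ↔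
      ∀ᶠ T in u, ζ.all.Realize ((C T).val ∘ Sum.inl) ((C T).val ∘ Sum.inr) := fun C =>
    Ultraproduct.boundedFormula_realize_cast ζ.all _ _
  have hAu := (hall A).2 (Filter.Eventually.of_forall hA)
  have hBu : ¬ ζ.all.Realize (ν B ∘ Sum.inl) (ν B ∘ Sum.inr) := fun h =>
    ((hall B).1 h).exists.elim hB
  rw [BoundedFormula.realize_all] at hAu hBu
  push Not at hBu
  obtain ⟨y, hy⟩ := hBu
  obtain ⟨T, hT⟩ := hζ.exists_finset_bdEqual
  let g : β ⊕ Fin (k + 1) → Option (β ⊕ Fin k) :=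
    Sum.elim (fun b => some (Sum.inl b)) (Fin.snoc (fun i => some (Sum.inr i)) none)
  have hg : ∀ {M : Type} (v : β ⊕ Fin k → M) (x : M),
      (fun o : Option (β ⊕ Fin k) => o.elim x v) ∘ g =
        Sum.elim (v ∘ Sum.inl) (Fin.snoc (v ∘ Sum.inr) x) := by
    intro M v x
    funext b
    obtain b | i := b
    · rfl
    · induction i using Fin.lastCases <;> simp [g]
  obtain ⟨z, hz⟩ := IsSHFStructure.exists_realization he
    (IsSHFStructure.ultraproduct u _ fun T => (B T).isSHFStructure)
    (IsSHFStructure.ultraproduct u _ fun T => (A T).isSHFStructure) hsame y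
    (T.image fun q => (q.1.relabel g, q.2.relabel g))
  refine hy ((hT _ _ _ _ _ _ fun q hq => ?_).2 (hAu z))
  have h := hz _ (Finset.mem_image_of_mem _ hq)
  simpa only [Term.realize_relabel, hg, BoundedFormula.realize_bdEqual] using h

/-- Every formula is equivalent to a quantifier-free formula in all models of `SHF-bar_{p,e}`. -/
theorem FirstOrder.Language.BoundedFormula.exists_isQF_shf {p e : ℕ} [Fact p.Prime]
    (he : 0 < e) {β : Type} {k : ℕ} (φ : shfLang.BoundedFormula β k) :
    ∃ ψ : shfLang.BoundedFormula β k, ψ.IsQF ∧ ∀ (M : Type) [shfLang.Structure M],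
      IsSHFStructure p e M → ∀ (v : β → M) (xs : Fin k → M),
        φ.Realize v xs ↔ ψ.Realize v xs := by
  induction φ with
  | falsum => exact ⟨_, .falsum, fun _ _ _ _ _ => Iff.rfl⟩
  | equal t s => exact ⟨_, (IsAtomic.equal t s).isQF, fun _ _ _ _ _ => Iff.rfl⟩
  | rel r _ => exact isEmptyElim r
  | imp _ _ ih₁ ih₂ =>
    obtain ⟨ψ₁, hψ₁, h₁⟩ := ih₁
    obtain ⟨ψ₂, hψ₂, h₂⟩ := ih₂
    exact ⟨_, hψ₁.imp hψ₂, fun M _ hM v xs => imp_congr (h₁ M hM v xs) (h₂ M hM v xs)⟩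
  | all _ ih =>
    obtain ⟨ζ, hζ, h⟩ := ih
    obtain ⟨ψ, hψ, h'⟩ := hζ.exists_isQF_all (p := p) he
    exact ⟨ψ, hψ, fun M _ hM v xs => Iff.trans
      (forall_congr' fun x => h M hM v (Fin.snoc xs x)) (h' M hM v xs)⟩

end QuantifierElimination

/-- The theory `SHF-bar_{p,e}` has quantifier elimination: every formula is equivalent,
modulo the theory, to a quantifier-free formula in the same free variables. -/
theorem shfTheory_quantifierElimination (p e : ℕ) [Fact p.Prime] (he : 1 ≤ e) :
    ∀ (m : ℕ) (φ : shfLang.Formula (Fin m)),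
      ∃ ζ : shfLang.Formula (Fin m), ζ.IsQF ∧ shfTheory p e ⊨ᵇ φ.iff ζ := by
  intro m φ
  obtain ⟨ζ, hζ, h⟩ := φ.exists_isQF_shf (p := p) (e := e) he
  have hmem : (BoundedFormula.relabel (Sum.inr : Fin m → Empty ⊕ Fin m) (φ.iff ζ)).alls ∈
      shfTheory p e := by
    intro M _ hM
    rw [Sentence.Realize, BoundedFormula.realize_alls]
    intro v
    rw [Formula.realize_relabel_sumInr, Formula.realize_iff]
    exact h M hM v default
  refine ⟨ζ, hζ, fun M v xs => ?_⟩
  have hM := Theory.realize_sentence_of_mem (M := M) _ hmem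
  rw [Sentence.Realize, BoundedFormula.realize_alls] at hM
  rw [Subsingleton.elim xs default]
  exact (Formula.realize_relabel_sumInr _).1 (hM v)
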